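/- arXiv:1103.3054 — 2 statements merged into one kernel-verified Lean document; each statement's English description precedes it below -/
import Mathlib

section
/- Sum-rate capacity (Corollary 1): For the two-user memoryless FS-MAC with i.i.d. state, causal asymmetric noisy CSIT and complete CSIR, the sum-rate capacity equals C^FS_Σ = sup_{π_{T^a}(t^a)π_{T^b}(t^b)} I(T^a,T^b;Y|S), where the supremum is over all product distributions π_{T^a}⊗π_{T^b} on Shannon strategies 𝒯^a×𝒯^b and the conditional mutual information is computed under the joint law induced by the team policy. -/
open scoped BigOperators
open Finset

noncomputable section

/-- Shannon entropy (base 2) of a pmf on a finite type (convention `0 * log 0 = 0`). -/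
def ent {α : Type} [Fintype α] (p : α → ℝ) : ℝ :=
  -∑ x, p x * Real.logb 2 (p x)

/-- `p` is a probability mass function. -/
def isPMF {α : Type} [Fintype α] (p : α → ℝ) : Prop :=
  (∀ x, 0 ≤ p x) ∧ ∑ x, p x = 1

/-- Mutual information `I(A;B)` computed from a joint pmf on `α × β`. -/
def mutInfo {α β : Type} [Fintype α] [Fintype β] (p : α × β → ℝ) : ℝ :=
  ent (fun a => ∑ b, p (a, b)) + ent (fun b => ∑ a, p (a, b)) - ent p

/-- Conditional mutual information `I(A;B|C)` computed from a joint pmf on `α × β × γ`. -/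
def condMutInfo {α β γ : Type} [Fintype α] [Fintype β] [Fintype γ]
    (p : α × β × γ → ℝ) : ℝ :=
  ent (fun ac : α × γ => ∑ b, p (ac.1, b, ac.2))
    + ent (fun bc : β × γ => ∑ a, p (a, bc.1, bc.2))
    - ent p
    - ent (fun c : γ => ∑ a, ∑ b, p (a, b, c))

/-- A two-user memoryless finite-state MAC with i.i.d. state, noisy causal CSIT
(through the kernels `Qa`, `Qb`) and complete CSIR. -/
structure FSMAC (S Sa Sb Xa Xb Y : Type) [Fintype S] [Fintype Sa] [Fintype Sb]
    [Fintype Xa] [Fintype Xb] [Fintype Y] : Type where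
  PS : S → ℝ
  Qa : S → Sa → ℝ
  Qb : S → Sb → ℝ
  chan : Xa → Xb → S → Y → ℝ
  PS_pmf : isPMF PS
  Qa_pmf : ∀ s, isPMF (Qa s)
  Qb_pmf : ∀ s, isPMF (Qb s)
  chan_pmf : ∀ xa xb s, isPMF (chan xa xb s)

variable {S Sa Sb Xa Xb Y : Type} [Fintype S] [Fintype Sa] [Fintype Sb]
  [Fintype Xa] [Fintype Xb] [Fintype Y] [DecidableEq Sa] [DecidableEq Sb]

/-- `P_{Y|T^a,T^b,S}(y|t^a,t^b,s)`: channel kernel at the level of Shannon strategies. -/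
def stratKernel (M : FSMAC S Sa Sb Xa Xb Y) (ta : Sa → Xa) (tb : Sb → Xb)
    (s : S) (y : Y) : ℝ :=
  ∑ sa, ∑ sb, M.Qa s sa * M.Qb s sb * M.chan (ta sa) (tb sb) s y

/-- Joint single-letter law of `((T^a,T^b),Y,S)` induced by a memoryless stationary
team policy `(πa, πb)`. -/
def teamLaw (M : FSMAC S Sa Sb Xa Xb Y) (πa : (Sa → Xa) → ℝ) (πb : (Sb → Xb) → ℝ) :
    ((Sa → Xa) × (Sb → Xb)) × Y × S → ℝ :=
  fun x => M.PS x.2.2 * πa x.1.1 * πb x.1.2 * stratKernel M x.1.1 x.1.2 x.2.2 x.2.1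

/-- `I(T^a;Y|T^b,S)` under the team policy law. -/
def Ia (M : FSMAC S Sa Sb Xa Xb Y) (πa : (Sa → Xa) → ℝ) (πb : (Sb → Xb) → ℝ) : ℝ :=
  condMutInfo (fun x : (Sa → Xa) × Y × ((Sb → Xb) × S) =>
    teamLaw M πa πb ((x.1, x.2.2.1), x.2.1, x.2.2.2))

/-- `I(T^b;Y|T^a,S)` under the team policy law. -/
def Ib (M : FSMAC S Sa Sb Xa Xb Y) (πa : (Sa → Xa) → ℝ) (πb : (Sb → Xb) → ℝ) : ℝ :=
  condMutInfo (fun x : (Sb → Xb) × Y × ((Sa → Xa) × S) =>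
    teamLaw M πa πb ((x.2.2.1, x.1), x.2.1, x.2.2.2))

/-- `I(T^a,T^b;Y|S)` under the team policy law. -/
def Isum (M : FSMAC S Sa Sb Xa Xb Y) (πa : (Sa → Xa) → ℝ) (πb : (Sb → Xb) → ℝ) : ℝ :=
  condMutInfo (teamLaw M πa πb)

/-- The region `ℛ(π)` of a memoryless stationary team policy `π = (πa, πb)`. -/
def rateRegion (M : FSMAC S Sa Sb Xa Xb Y) (πa : (Sa → Xa) → ℝ)
    (πb : (Sb → Xb) → ℝ) : Set (ℝ × ℝ) :=
  {R : ℝ × ℝ | 0 ≤ R.1 ∧ 0 ≤ R.2 ∧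
    R.1 < Ia M πa πb ∧ R.2 < Ib M πa πb ∧ R.1 + R.2 < Isum M πa πb}

/-- A block code with causal encoders (encoder `a` sees `S^a_{[t]}`, encoder `b`
sees `S^b_{[t]}`) and a decoder with complete state information. -/
structure Code (M : FSMAC S Sa Sb Xa Xb Y) (n : ℕ) (Wa Wb : Type) : Type where
  encA : (t : Fin n) → (Fin (t.1 + 1) → Sa) → Wa → Xa
  encB : (t : Fin n) → (Fin (t.1 + 1) → Sb) → Wb → Xb
  dec : (Fin n → S) → (Fin n → Y) → Wa × Wb

/-- Joint pmf on messages, state sequences, noisy-observation sequences and outputs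
induced by a code (messages uniform and independent; memoryless channel and state). -/
def codeProb (M : FSMAC S Sa Sb Xa Xb Y) {n : ℕ} {Wa Wb : Type}
    [Fintype Wa] [Fintype Wb] (C : Code M n Wa Wb) (wa : Wa) (wb : Wb)
    (s : Fin n → S) (sa : Fin n → Sa) (sb : Fin n → Sb) (y : Fin n → Y) : ℝ :=
  (Fintype.card Wa : ℝ)⁻¹ * (Fintype.card Wb : ℝ)⁻¹ *
    ∏ t : Fin n,
      (M.PS (s t) * M.Qa (s t) (sa t) * M.Qb (s t) (sb t) *
        M.chan (C.encA t (fun i => sa (Fin.castLE t.isLt i)) wa)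
          (C.encB t (fun i => sb (Fin.castLE t.isLt i)) wb) (s t) (y t))

open Classical in
/-- Probability of an event under the code-induced joint law. -/
def codePr (M : FSMAC S Sa Sb Xa Xb Y) {n : ℕ} {Wa Wb : Type}
    [Fintype Wa] [Fintype Wb] (C : Code M n Wa Wb)
    (E : Wa → Wb → (Fin n → S) → (Fin n → Sa) → (Fin n → Sb) → (Fin n → Y) → Prop) : ℝ :=
  ∑ wa, ∑ wb, ∑ s, ∑ sa, ∑ sb, ∑ y,
    if E wa wb s sa sb y then codeProb M C wa wb s sa sb y else 0

/-- Average probability of error of a code. -/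
def errProb (M : FSMAC S Sa Sb Xa Xb Y) {n : ℕ} {Wa Wb : Type}
    [Fintype Wa] [Fintype Wb] (C : Code M n Wa Wb) : ℝ :=
  codePr M C (fun wa wb s _ _ y => C.dec s y ≠ (wa, wb))

/-- A rate pair is achievable if for every `ε > 0` and all large enough `n` there is a
code of blocklength `n` with rates at least `(Ra, Rb)` and error probability `≤ ε`. -/
def Achievable (M : FSMAC S Sa Sb Xa Xb Y) (Ra Rb : ℝ) : Prop :=
  0 ≤ Ra ∧ 0 ≤ Rb ∧
    ∀ ε : ℝ, 0 < ε → ∃ N : ℕ, ∀ n : ℕ, N ≤ n →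
      ∃ (Ma Mb : ℕ) (C : Code M n (Fin Ma) (Fin Mb)),
        Ra ≤ Real.logb 2 Ma / n ∧ Rb ≤ Real.logb 2 Mb / n ∧ errProb M C ≤ ε

/-- The capacity region `C_FS`: closure of the set of achievable rate pairs. -/
def capRegion (M : FSMAC S Sa Sb Xa Xb Y) : Set (ℝ × ℝ) :=
  closure {R : ℝ × ℝ | Achievable M R.1 R.2}

/-- `sup_{π_{T^a} ⊗ π_{T^b}} I(T^a,T^b;Y|S)`. -/
def sumRateSup (M : FSMAC S Sa Sb Xa Xb Y) : ℝ :=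
  sSup {x : ℝ | ∃ (πa : (Sa → Xa) → ℝ) (πb : (Sb → Xb) → ℝ),
    isPMF πa ∧ isPMF πb ∧ x = Isum M πa πb}

/-- Binary entropy function (base 2). -/
def binEnt (x : ℝ) : ℝ := -(x * Real.logb 2 x) - (1 - x) * Real.logb 2 (1 - x)

set_option linter.unusedSectionVars false
set_option linter.unusedVariables false

/-! ### Elementary inequalities -/

lemma gibbs_elem {a b : ℝ} (ha : 0 ≤ a) (hb : 0 ≤ b) (hab : b = 0 → a = 0) :
    a - b ≤ a * Real.log (a / b) := by
  rcases ha.eq_or_lt with h | h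
  · subst h; simpa using hb
  · have hb' : 0 < b := lt_of_le_of_ne hb (fun h0 => by have := hab h0.symm; linarith)
    have h1 : Real.log (b / a) ≤ b / a - 1 := Real.log_le_sub_one_of_pos (by positivity)
    have h2 : Real.log (a / b) = - Real.log (b / a) := by
      rw [← Real.log_inv, inv_div]
    rw [h2]
    have h3 : a * Real.log (b / a) ≤ a * (b / a - 1) := mul_le_mul_of_nonneg_left h1 ha
    have h4 : a * (b / a - 1) = b - a := by field_simp
    linarith

/-- Log-sum inequality. -/
lemma log_sum_ineq {U : Type} [Fintype U] (a b : U → ℝ) (ha : ∀ u, 0 ≤ a u) (hb : ∀ u, 0 ≤ b u)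
    (hab : ∀ u, b u = 0 → a u = 0) :
    (∑ u, a u) * Real.log ((∑ u, a u) / (∑ u, b u)) ≤ ∑ u, a u * Real.log (a u / b u) := by
  set A := ∑ u, a u with hA
  set B := ∑ u, b u with hB
  have hA0 : 0 ≤ A := Finset.sum_nonneg fun u _ => ha u
  have hB0 : 0 ≤ B := Finset.sum_nonneg fun u _ => hb u
  rcases hA0.eq_or_lt with h | h
  · have : ∀ u, a u = 0 := by
      intro u
      have := (Finset.sum_eq_zero_iff_of_nonneg (fun u _ => ha u)).1 (hA.symm.trans h.symm)
      exact this u (Finset.mem_univ u)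
    simp [this, ← h]
  · have hBp : 0 < B := by
      refine lt_of_le_of_ne hB0 fun h0 => ?_
      have hz := (Finset.sum_eq_zero_iff_of_nonneg (fun u _ => hb u)).1 (hB.symm.trans h0.symm)
      have : A = 0 := Finset.sum_eq_zero fun u hu => hab u (hz u hu)
      linarith
    have key : ∀ u, a u - b u * (A / B) + a u * Real.log (A / B) ≤ a u * Real.log (a u / b u) := by
      intro u
      have h1 := gibbs_elem (ha u) (b := b u * (A / B)) (mul_nonneg (hb u) (by positivity))
        (fun h0 => hab u (by
          rcases mul_eq_zero.1 h0 with h' | h'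
          · exact h'
          · have : 0 < A / B := by positivity
            linarith))
      rcases (ha u).eq_or_lt with h' | h'
      · rw [← h'] at h1 ⊢; simpa using h1
      · have hbu : 0 < b u := lt_of_le_of_ne (hb u) (fun h0 => by
          have := hab u h0.symm; linarith)
        have : Real.log (a u / (b u * (A / B))) = Real.log (a u / b u) - Real.log (A / B) := by
          rw [← Real.log_div (by positivity) (by positivity)]; congr 1; field_simp
        rw [this] at h1
        linarith
    have := Finset.sum_le_sum fun u (_ : u ∈ Finset.univ) => key u
    rw [Finset.sum_add_distrib, Finset.sum_sub_distrib, ← Finset.sum_mul, ← Finset.sum_mul,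
      ← hA, ← hB] at this
    have e : B * (A / B) = A := by field_simp
    rw [e] at this
    linarith

/-- Exponential form of the weak law of large numbers. -/
lemma wlln {Ω : Type} [Fintype Ω] (P : Ω → ℝ) (hP : isPMF P) (F : Ω → ℝ) (c : ℝ)
    (hc : c < ∑ x, P x * F x) (ε : ℝ) (hε : 0 < ε) :
    ∃ N : ℕ, ∀ n : ℕ, N ≤ n →
      ∑ ω : Fin n → Ω, (∏ t, P (ω t)) * (if ∑ t, F (ω t) ≤ n * c then 1 else 0) ≤ ε := by
  obtain ⟨l, hl0, hl⟩ : ∃ l : ℝ, 0 < l ∧ ∑ x, P x * Real.exp (l * (c - F x)) < 1 := by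
    have hd : HasDerivAt (fun l : ℝ => ∑ x, P x * Real.exp (l * (c - F x)))
        (∑ x, P x * (c - F x)) 0 := by
      have : ∀ x ∈ (Finset.univ : Finset Ω), HasDerivAt (fun l : ℝ => P x * Real.exp (l * (c - F x)))
          (P x * (c - F x)) 0 := by
        intro x _
        have h1 : HasDerivAt (fun l : ℝ => l * (c - F x)) (c - F x) 0 := by
          simpa using (hasDerivAt_id (0:ℝ)).mul_const (c - F x)
        have h2 := (h1.exp).const_mul (P x)
        simpa using h2
      exact HasDerivAt.fun_sum this
    have hneg : ∑ x, P x * (c - F x) < 0 := by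
      have : ∑ x, P x * (c - F x) = c - ∑ x, P x * F x := by
        simp only [mul_sub, Finset.sum_sub_distrib, ← Finset.sum_mul, hP.2, one_mul]
      linarith
    rw [hasDerivAt_iff_tendsto_slope_zero] at hd
    have h1 := hd.mono_left (nhdsWithin_mono (0:ℝ) (s := Set.Ioi 0) (fun x hx => ne_of_gt hx))
    have h2 := (h1.eventually (gt_mem_nhds hneg)).and self_mem_nhdsWithin
    obtain ⟨l, hl1, hl2⟩ := h2.exists
    have hl2 : 0 < l := hl2
    refine ⟨l, hl2, ?_⟩
    simp only [zero_add, zero_mul, Real.exp_zero, mul_one, hP.2, smul_eq_mul] at hl1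
    by_contra hcon
    have : 0 ≤ l⁻¹ * (∑ x, P x * Real.exp (l * (c - F x)) - 1) :=
      mul_nonneg (inv_pos.2 hl2).le (by linarith)
    linarith
  set ρ := ∑ x, P x * Real.exp (l * (c - F x)) with hρ
  have hρ0 : 0 ≤ ρ := Finset.sum_nonneg fun x _ => mul_nonneg (hP.1 x) (Real.exp_pos _).le
  have ht := (tendsto_pow_atTop_nhds_zero_of_lt_one hρ0 hl).eventually (gt_mem_nhds hε)
  obtain ⟨N, hN⟩ := Filter.eventually_atTop.1 ht
  refine ⟨N, fun n hn => le_trans ?_ (hN n hn).le⟩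
  have hpow : ρ ^ n = ∑ ω : Fin n → Ω, ∏ t, (P (ω t) * Real.exp (l * (c - F (ω t)))) := by
    have := Finset.prod_univ_sum (fun _ : Fin n => (Finset.univ : Finset Ω))
      (fun _ x => P x * Real.exp (l * (c - F x)))
    rw [Fintype.piFinset_univ] at this
    rw [← this]; simp [hρ]
  rw [hpow]
  refine Finset.sum_le_sum fun ω _ => ?_
  rw [Finset.prod_mul_distrib]
  refine mul_le_mul_of_nonneg_left ?_ (Finset.prod_nonneg fun t _ => hP.1 _)
  rw [← Real.exp_sum]
  split_ifs with h
  · apply Real.one_le_exp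
    rw [← Finset.mul_sum]
    apply mul_nonneg hl0.le
    simp only [Finset.sum_sub_distrib, Finset.sum_const, Finset.card_univ, Fintype.card_fin,
      nsmul_eq_mul]
    linarith
  · exact (Real.exp_pos _).le

/-! ### Formula for the conditional mutual information -/

lemma condMutInfo_eq {α β γ : Type} [Fintype α] [Fintype β] [Fintype γ] (p : α × β × γ → ℝ) :
    condMutInfo p = ∑ a, ∑ b, ∑ c, p (a, b, c) * (Real.logb 2 (p (a, b, c))
      + Real.logb 2 (∑ a', ∑ b', p (a', b', c)) - Real.logb 2 (∑ b', p (a, b', c))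
      - Real.logb 2 (∑ a', p (a', b, c))) := by
  have h1 : ent (fun ac : α × γ => ∑ b, p (ac.1, b, ac.2)) =
      -∑ a, ∑ b, ∑ c, p (a, b, c) * Real.logb 2 (∑ b', p (a, b', c)) := by
    simp only [ent, Fintype.sum_prod_type, Finset.sum_mul]
    congr 1
    refine Finset.sum_congr rfl fun a _ => ?_
    rw [Finset.sum_comm]
  have h2 : ent (fun bc : β × γ => ∑ a, p (a, bc.1, bc.2)) =
      -∑ a, ∑ b, ∑ c, p (a, b, c) * Real.logb 2 (∑ a', p (a', b, c)) := by
    simp only [ent, Fintype.sum_prod_type, Finset.sum_mul]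
    congr 1
    rw [Finset.sum_comm (s := (Finset.univ : Finset α))]
    refine Finset.sum_congr rfl fun b _ => ?_
    rw [Finset.sum_comm]
  have h3 : ent p = -∑ a, ∑ b, ∑ c, p (a, b, c) * Real.logb 2 (p (a, b, c)) := by
    simp only [ent, Fintype.sum_prod_type]
  have h4 : ent (fun c : γ => ∑ a, ∑ b, p (a, b, c)) =
      -∑ a, ∑ b, ∑ c, p (a, b, c) * Real.logb 2 (∑ a', ∑ b', p (a', b', c)) := by
    simp only [ent, Finset.sum_mul]
    congr 1
    rw [Finset.sum_comm]
    refine Finset.sum_congr rfl fun a _ => ?_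
    rw [Finset.sum_comm]
  rw [condMutInfo, h1, h2, h3, h4]
  simp only [mul_sub, mul_add, Finset.sum_sub_distrib, Finset.sum_add_distrib]
  ring

/-- The kernel from strategies to (state, output) pairs. -/
def kk (M : FSMAC S Sa Sb Xa Xb Y) (ta : Sa → Xa) (tb : Sb → Xb) (s : S) (y : Y) : ℝ :=
  M.PS s * stratKernel M ta tb s y

/-- Output law induced by a team policy. -/
def rr (M : FSMAC S Sa Sb Xa Xb Y) (πa : (Sa → Xa) → ℝ) (πb : (Sb → Xb) → ℝ)
    (s : S) (y : Y) : ℝ :=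
  ∑ ta, ∑ tb, πa ta * πb tb * kk M ta tb s y

lemma stratKernel_nonneg (M : FSMAC S Sa Sb Xa Xb Y) (ta : Sa → Xa) (tb : Sb → Xb) (s : S) (y : Y) :
    0 ≤ stratKernel M ta tb s y :=
  Finset.sum_nonneg fun sa _ => Finset.sum_nonneg fun sb _ =>
    mul_nonneg (mul_nonneg ((M.Qa_pmf s).1 sa) ((M.Qb_pmf s).1 sb)) ((M.chan_pmf _ _ s).1 y)

lemma stratKernel_sum (M : FSMAC S Sa Sb Xa Xb Y) (ta : Sa → Xa) (tb : Sb → Xb) (s : S) :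
    ∑ y, stratKernel M ta tb s y = 1 := by
  simp only [stratKernel]
  rw [Finset.sum_comm]
  have : ∀ sa, ∑ y, ∑ sb, M.Qa s sa * M.Qb s sb * M.chan (ta sa) (tb sb) s y = M.Qa s sa := by
    intro sa
    rw [Finset.sum_comm]
    simp only [← Finset.mul_sum, (M.chan_pmf _ _ s).2, mul_one, (M.Qb_pmf s).2]
  simp only [this, (M.Qa_pmf s).2]

lemma kk_nonneg (M : FSMAC S Sa Sb Xa Xb Y) (ta : Sa → Xa) (tb : Sb → Xb) (s : S) (y : Y) :
    0 ≤ kk M ta tb s y := mul_nonneg (M.PS_pmf.1 s) (stratKernel_nonneg M ta tb s y)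

lemma kk_sum (M : FSMAC S Sa Sb Xa Xb Y) (ta : Sa → Xa) (tb : Sb → Xb) :
    ∑ s, ∑ y, kk M ta tb s y = 1 := by
  simp only [kk, ← Finset.mul_sum, stratKernel_sum, mul_one, M.PS_pmf.2]

lemma rr_nonneg (M : FSMAC S Sa Sb Xa Xb Y) {πa : (Sa → Xa) → ℝ} {πb : (Sb → Xb) → ℝ}
    (ha : ∀ t, 0 ≤ πa t) (hb : ∀ t, 0 ≤ πb t) (s : S) (y : Y) : 0 ≤ rr M πa πb s y :=
  Finset.sum_nonneg fun ta _ => Finset.sum_nonneg fun tb _ =>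
    mul_nonneg (mul_nonneg (ha ta) (hb tb)) (kk_nonneg M ta tb s y)

lemma rr_ge (M : FSMAC S Sa Sb Xa Xb Y) {πa : (Sa → Xa) → ℝ} {πb : (Sb → Xb) → ℝ}
    (ha : ∀ t, 0 ≤ πa t) (hb : ∀ t, 0 ≤ πb t) (ta : Sa → Xa) (tb : Sb → Xb) (s : S) (y : Y) :
    πa ta * πb tb * kk M ta tb s y ≤ rr M πa πb s y := by
  have h1 : ∀ ta tb, 0 ≤ πa ta * πb tb * kk M ta tb s y := fun ta tb =>
    mul_nonneg (mul_nonneg (ha ta) (hb tb)) (kk_nonneg M ta tb s y)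
  have h2 := Finset.single_le_sum (f := fun tb => πa ta * πb tb * kk M ta tb s y)
    (fun tb _ => h1 ta tb) (Finset.mem_univ tb)
  have h3 := Finset.single_le_sum (f := fun ta => ∑ tb, πa ta * πb tb * kk M ta tb s y)
    (fun ta _ => Finset.sum_nonneg fun tb _ => h1 ta tb) (Finset.mem_univ ta)
  exact h2.trans h3

lemma rr_sum (M : FSMAC S Sa Sb Xa Xb Y) {πa : (Sa → Xa) → ℝ} {πb : (Sb → Xb) → ℝ}
    (ha : isPMF πa) (hb : isPMF πb) : ∑ s, ∑ y, rr M πa πb s y = 1 := by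
  have h : ∀ s, ∑ y, rr M πa πb s y = M.PS s := by
    intro s
    simp only [rr]
    rw [Finset.sum_comm]
    have : ∀ ta, ∑ y, ∑ tb, πa ta * πb tb * kk M ta tb s y = πa ta * M.PS s := by
      intro ta
      rw [Finset.sum_comm]
      simp only [kk, ← Finset.mul_sum, stratKernel_sum, mul_one, ← Finset.sum_mul, hb.2]
    simp only [this, ← Finset.sum_mul, ha.2, one_mul]
  simp only [h, M.PS_pmf.2]

lemma Isum_eq (M : FSMAC S Sa Sb Xa Xb Y) {πa : (Sa → Xa) → ℝ} {πb : (Sb → Xb) → ℝ}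
    (ha : isPMF πa) (hb : isPMF πb) :
    Isum M πa πb * Real.log 2 = ∑ ta, ∑ tb, ∑ s, ∑ y, πa ta * πb tb * kk M ta tb s y *
      Real.log (kk M ta tb s y / rr M πa πb s y) := by
  rw [Isum, condMutInfo_eq, Finset.sum_mul, Fintype.sum_prod_type]
  refine Finset.sum_congr rfl fun ta _ => Finset.sum_congr rfl fun tb _ => ?_
  rw [Finset.sum_mul, Finset.sum_comm (s := (Finset.univ : Finset S))]
  refine Finset.sum_congr rfl fun y _ => ?_
  rw [Finset.sum_mul]
  refine Finset.sum_congr rfl fun s _ => ?_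
  have e1 : ∀ ta tb, ∑ y', teamLaw M πa πb ((ta, tb), y', s) = M.PS s * πa ta * πb tb := by
    intro ta tb
    simp only [teamLaw, ← Finset.mul_sum, stratKernel_sum, mul_one]
  have e2 : ∑ a', ∑ b', teamLaw M πa πb (a', b', s) = M.PS s := by
    rw [Fintype.sum_prod_type]
    simp only [e1, ← Finset.mul_sum, ha.2, hb.2, mul_one]
  have e3 : ∑ a', teamLaw M πa πb (a', y, s) = rr M πa πb s y := by
    rw [Fintype.sum_prod_type]
    simp only [rr, teamLaw, kk]
    refine Finset.sum_congr rfl fun ta _ => Finset.sum_congr rfl fun tb _ => by ring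
  rw [e1, e2, e3]
  have e4 : teamLaw M πa πb ((ta, tb), y, s) = πa ta * πb tb * kk M ta tb s y := by
    simp only [teamLaw, kk]; ring
  rw [e4]
  by_cases h : πa ta * πb tb * kk M ta tb s y = 0
  · simp [h]
  · have hk : kk M ta tb s y ≠ 0 := right_ne_zero_of_mul h
    have hpa : πa ta ≠ 0 := left_ne_zero_of_mul (left_ne_zero_of_mul h)
    have hpb : πb tb ≠ 0 := right_ne_zero_of_mul (left_ne_zero_of_mul h)
    have hS : M.PS s ≠ 0 := left_ne_zero_of_mul hk
    have hr : rr M πa πb s y ≠ 0 := by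
      have h1 := rr_ge M ha.1 hb.1 ta tb s y
      have h2 : 0 ≤ πa ta * πb tb * kk M ta tb s y :=
        mul_nonneg (mul_nonneg (ha.1 ta) (hb.1 tb)) (kk_nonneg M ta tb s y)
      have := lt_of_le_of_ne h2 (Ne.symm h)
      exact (this.trans_le h1).ne'
    have l2 : Real.log 2 ≠ 0 := (Real.log_pos one_lt_two).ne'
    simp only [Real.logb]
    rw [Real.log_div hk hr, Real.log_mul (mul_ne_zero hpa hpb) hk, Real.log_mul hpa hpb,
      Real.log_mul (mul_ne_zero hS hpa) hpb, Real.log_mul hS hpa]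
    field_simp
    ring

/-! ### Boundedness of `Isum` -/

lemma ent_nonneg {α : Type} [Fintype α] (p : α → ℝ) (h : isPMF p) : 0 ≤ ent p := by
  rw [ent, ← Finset.sum_neg_distrib]
  refine Finset.sum_nonneg fun x _ => ?_
  have h1 : p x ≤ 1 := by
    rw [← h.2]; exact Finset.single_le_sum (fun y _ => h.1 y) (Finset.mem_univ x)
  have := Real.logb_nonpos one_lt_two (h.1 x) h1
  nlinarith [h.1 x]

lemma ent_le {α : Type} [Fintype α] (p : α → ℝ) (h : isPMF p) :
    ent p ≤ Fintype.card α / Real.log 2 := by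
  rw [ent, ← Finset.sum_neg_distrib]
  have : ∀ x ∈ (Finset.univ : Finset α), -(p x * Real.logb 2 (p x)) ≤ 1 / Real.log 2 := by
    intro x _
    have h1 := gibbs_elem (h.1 x) (zero_le_one) (by simp)
    rw [div_one] at h1
    have l2 := Real.log_pos one_lt_two
    rw [Real.logb, ← mul_div_assoc, ← neg_div]
    gcongr
    linarith [h.1 x]
  refine (Finset.sum_le_sum this).trans (le_of_eq ?_)
  simp [Finset.card_univ, div_eq_mul_inv]

lemma Isum_bdd (M : FSMAC S Sa Sb Xa Xb Y) :
    BddAbove {x : ℝ | ∃ (πa : (Sa → Xa) → ℝ) (πb : (Sb → Xb) → ℝ),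
      isPMF πa ∧ isPMF πb ∧ x = Isum M πa πb} := by
  refine ⟨Fintype.card (((Sa → Xa) × (Sb → Xb)) × S) / Real.log 2 +
    Fintype.card (Y × S) / Real.log 2, ?_⟩
  rintro x ⟨πa, πb, ha, hb, rfl⟩
  have n0 : ∀ x, 0 ≤ teamLaw M πa πb x := fun x =>
    mul_nonneg (mul_nonneg (mul_nonneg (M.PS_pmf.1 _) (ha.1 _)) (hb.1 _)) (stratKernel_nonneg M _ _ _ _)
  have e1 : ∀ t s, ∑ y', teamLaw M πa πb (t, y', s) = M.PS s * πa t.1 * πb t.2 := by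
    intro t s
    simp only [teamLaw, ← Finset.mul_sum, stratKernel_sum, mul_one]
  have e2 : ∀ s, ∑ a', ∑ b', teamLaw M πa πb (a', b', s) = M.PS s := by
    intro s
    rw [Fintype.sum_prod_type]
    simp only [e1, ← Finset.mul_sum, ha.2, hb.2, mul_one]
  have tot : ∑ s, ∑ a', ∑ b', teamLaw M πa πb (a', b', s) = 1 := by
    simp only [e2, M.PS_pmf.2]
  have b1 := ent_le (fun ac : ((Sa → Xa) × (Sb → Xb)) × S => ∑ b, teamLaw M πa πb (ac.1, b, ac.2))
    ⟨fun _ => Finset.sum_nonneg fun _ _ => n0 _, by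
      rw [Fintype.sum_prod_type, Finset.sum_comm]; exact tot⟩
  have b2 := ent_le (fun bc : Y × S => ∑ a, teamLaw M πa πb (a, bc.1, bc.2))
    ⟨fun _ => Finset.sum_nonneg fun _ _ => n0 _, by
      rw [Fintype.sum_prod_type, Finset.sum_comm, ← tot]
      exact Finset.sum_congr rfl fun s _ => Finset.sum_comm⟩
  have b3 := ent_nonneg (teamLaw M πa πb) ⟨n0, by
      rw [← tot, Fintype.sum_prod_type, Finset.sum_comm (s := (Finset.univ : Finset S))]
      refine Finset.sum_congr rfl fun t _ => ?_
      rw [Fintype.sum_prod_type, Finset.sum_comm]⟩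
  have b4 := ent_nonneg (fun s => ∑ a', ∑ b', teamLaw M πa πb (a', b', s))
    ⟨fun _ => Finset.sum_nonneg fun _ _ => Finset.sum_nonneg fun _ _ => n0 _, tot⟩
  rw [Isum, condMutInfo]
  linarith

/-! ### Converse -/

lemma sum_snoc {α : Type} [Fintype α] {n : ℕ} (F : (Fin (n + 1) → α) → ℝ) :
    ∑ f, F f = ∑ g : Fin n → α, ∑ a, F (Fin.snoc g a) := by
  rw [← (Fin.snocEquiv (fun _ : Fin (n + 1) => α)).sum_comp, Fintype.sum_prod_type, Finset.sum_comm]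
  rfl

lemma sum_pi_prod {α : Type} [Fintype α] {n : ℕ} (f : Fin n → α → ℝ) :
    ∑ x : Fin n → α, ∏ t, f t (x t) = ∏ t, ∑ a, f t a := by
  have := Finset.prod_univ_sum (fun _ : Fin n => (Finset.univ : Finset α)) f
  rw [Fintype.piFinset_univ] at this
  exact this.symm

/-- Fano-type bound. -/
lemma fano_bound {W Z : Type} [Fintype W] [Nonempty W] [Fintype Z] [DecidableEq W]
    (P : W → Z → ℝ) (Q : Z → ℝ)
    (hP : ∀ w z, 0 ≤ P w z) (hPs : ∀ w, ∑ z, P w z = 1) (hQ : isPMF Q)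
    (hPQ : ∀ w z, Q z = 0 → P w z = 0) (dec : Z → W) :
    (Fintype.card W - ∑ w, ∑ z, (if dec z ≠ w then P w z else 0)) * Real.log (Fintype.card W)
      - Fintype.card W ≤ ∑ w, ∑ z, P w z * Real.log (P w z / Q z) := by
  set m : ℝ := (Fintype.card W : ℝ) with hm
  have hm0 : 0 < m := by rw [hm]; exact_mod_cast Fintype.card_pos
  have key : ∀ w z, P w z - Q z * (if dec z = w then m else 1) +
      (P w z - if dec z ≠ w then P w z else 0) * Real.log m ≤ P w z * Real.log (P w z / Q z) := by
    intro w z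
    have hc : 0 < (if dec z = w then m else 1) := by split_ifs <;> positivity
    have h1 := gibbs_elem (hP w z) (mul_nonneg (hQ.1 z) hc.le)
      (fun h => hPQ w z (by
        rcases mul_eq_zero.1 h with h | h
        · exact h
        · exact absurd h hc.ne'))
    rcases (hP w z).eq_or_lt with h | h
    · rw [← h] at h1 ⊢; simpa using h1
    · have hQz : Q z ≠ 0 := fun h0 => by have := hPQ w z h0; linarith
      rw [← div_div, Real.log_div (by positivity) hc.ne'] at h1
      by_cases hd : dec z = w
      · simp only [hd, if_true, ne_eq, not_true_eq_false, if_false] at h1 ⊢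
        linarith
      · simp only [hd, if_false, ne_eq, not_false_eq_true, if_true, Real.log_one] at h1 ⊢
        linarith
  have h2 := Finset.sum_le_sum fun w (_ : w ∈ Finset.univ) =>
    Finset.sum_le_sum fun z (_ : z ∈ Finset.univ) => key w z
  simp only [Finset.sum_add_distrib, Finset.sum_sub_distrib, ← Finset.sum_mul, hPs] at h2
  have h3 : ∑ w, ∑ z, Q z * (if dec z = w then m else 1) ≤ 2 * m := by
    rw [Finset.sum_comm]
    simp only [← Finset.mul_sum]
    have : ∀ z ∈ (Finset.univ : Finset Z), Q z * ∑ w, (if dec z = w then m else 1) ≤ Q z * (2 * m) := by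
      intro z _
      refine mul_le_mul_of_nonneg_left ?_ (hQ.1 z)
      have : ∀ w ∈ (Finset.univ : Finset W), (if dec z = w then m else 1) ≤ (if dec z = w then m else 0) + 1 := by
        intro w _; split_ifs <;> linarith
      refine (Finset.sum_le_sum this).trans (le_of_eq ?_)
      rw [Finset.sum_add_distrib, Finset.sum_ite_eq]
      simp [hm]; ring
    refine (Finset.sum_le_sum this).trans (le_of_eq ?_)
    rw [← Finset.sum_mul, hQ.2, one_mul]
  have h4 : ∑ w : W, (1 : ℝ) = m := by simp [hm]
  rw [h4] at h2
  linarith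

open Classical in
/-- Law of the strategy used at a given time, given the past states. -/
def push {W V T : Type} [Fintype W] [Fintype V] (τ : W → V → T) (q : V → ℝ) (t : T) : ℝ :=
  (Fintype.card W : ℝ)⁻¹ * ∑ w, ∑ v, q v * if t = τ w v then 1 else 0

lemma push_sum {W V T : Type} [Fintype W] [Fintype V] [Fintype T] (τ : W → V → T) (q : V → ℝ)
    (G : T → ℝ) :
    ∑ t, push τ q t * G t = (Fintype.card W : ℝ)⁻¹ * ∑ w, ∑ v, q v * G (τ w v) := by
  classical
  simp only [push, mul_assoc, ← Finset.mul_sum, Finset.sum_mul]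
  congr 1
  rw [Finset.sum_comm]
  refine Finset.sum_congr rfl fun w _ => ?_
  rw [Finset.sum_comm]
  refine Finset.sum_congr rfl fun v _ => ?_
  rw [← Finset.mul_sum]
  congr 1
  simp [ite_mul]

lemma push_pmf {W V T : Type} [Fintype W] [Nonempty W] [Fintype V] [Fintype T]
    (τ : W → V → T) (q : V → ℝ) (hq : isPMF q) : isPMF (push τ q) := by
  classical
  constructor
  · intro t
    refine mul_nonneg (by positivity) (Finset.sum_nonneg fun w _ => Finset.sum_nonneg fun v _ => ?_)
    refine mul_nonneg (hq.1 v) ?_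
    split_ifs <;> norm_num
  · have := push_sum τ q (fun _ => 1)
    simp only [mul_one, hq.2] at this
    rw [this]
    have : (Fintype.card W : ℝ) ≠ 0 := by exact_mod_cast Fintype.card_ne_zero
    simp [this]

lemma push_zero {W V T : Type} [Fintype W] [Nonempty W] [Fintype V]
    (τ : W → V → T) (q : V → ℝ) (hq : ∀ v, 0 ≤ q v) (w : W) (v : V)
    (h : push τ q (τ w v) = 0) : q v = 0 := by
  classical
  have hc : (Fintype.card W : ℝ)⁻¹ ≠ 0 := inv_ne_zero (by exact_mod_cast Fintype.card_ne_zero)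
  have h0 : ∀ w' v', 0 ≤ q v' * (if τ w v = τ w' v' then (1 : ℝ) else 0) := by
    intro w' v'
    refine mul_nonneg (hq v') ?_
    split_ifs <;> norm_num
  have h1 := (mul_eq_zero.1 h).resolve_left hc
  have h2 := (Finset.sum_eq_zero_iff_of_nonneg (fun w' _ =>
    Finset.sum_nonneg fun v' _ => h0 w' v')).1 h1 w (Finset.mem_univ w)
  have h3 := (Finset.sum_eq_zero_iff_of_nonneg (fun v' _ => h0 w v')).1 h2 v (Finset.mem_univ v)
  simpa using h3

section conv

variable {Wa Wb : Type} [Fintype Wa] [Fintype Wb] [Nonempty Wa] [Nonempty Wb]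

/-- Conditional law of all sequences given the messages, for causal encoders. -/
def jp (M : FSMAC S Sa Sb Xa Xb Y) (eA : (t : ℕ) → (Fin (t + 1) → Sa) → Wa → Xa)
    (eB : (t : ℕ) → (Fin (t + 1) → Sb) → Wb → Xb) (n : ℕ) (wa : Wa) (wb : Wb)
    (s : Fin n → S) (sa : Fin n → Sa) (sb : Fin n → Sb) (y : Fin n → Y) : ℝ :=
  ∏ t : Fin n, (M.PS (s t) * M.Qa (s t) (sa t) * M.Qb (s t) (sb t) *
    M.chan (eA t (fun i => sa (Fin.castLE t.isLt i)) wa)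
      (eB t (fun i => sb (Fin.castLE t.isLt i)) wb) (s t) (y t))

/-- Conditional law of states and outputs given the messages. -/
def pw (M : FSMAC S Sa Sb Xa Xb Y) (eA : (t : ℕ) → (Fin (t + 1) → Sa) → Wa → Xa)
    (eB : (t : ℕ) → (Fin (t + 1) → Sb) → Wb → Xb) (n : ℕ) (wa : Wa) (wb : Wb)
    (s : Fin n → S) (y : Fin n → Y) : ℝ :=
  ∑ sa, ∑ sb, jp M eA eB n wa wb s sa sb y

variable (M : FSMAC S Sa Sb Xa Xb Y) (eA : (t : ℕ) → (Fin (t + 1) → Sa) → Wa → Xa)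
    (eB : (t : ℕ) → (Fin (t + 1) → Sb) → Wb → Xb)

lemma jp_nonneg (n : ℕ) (wa : Wa) (wb : Wb)
    (s : Fin n → S) (sa : Fin n → Sa) (sb : Fin n → Sb) (y : Fin n → Y) :
    0 ≤ jp M eA eB n wa wb s sa sb y :=
  Finset.prod_nonneg fun t _ => mul_nonneg (mul_nonneg (mul_nonneg (M.PS_pmf.1 _)
    ((M.Qa_pmf _).1 _)) ((M.Qb_pmf _).1 _)) ((M.chan_pmf _ _ _).1 _)

lemma jp_snoc (n : ℕ) (wa : Wa) (wb : Wb)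
    (s : Fin n → S) (sa : Fin n → Sa) (sb : Fin n → Sb) (y : Fin n → Y)
    (s' : S) (a' : Sa) (b' : Sb) (y' : Y) :
    jp M eA eB (n + 1) wa wb (Fin.snoc s s') (Fin.snoc sa a') (Fin.snoc sb b') (Fin.snoc y y') =
    jp M eA eB n wa wb s sa sb y * (M.PS s' * M.Qa s' a' * M.Qb s' b' *
      M.chan (eA n (Fin.snoc sa a') wa) (eB n (Fin.snoc sb b') wb) s' y') := by
  unfold jp
  rw [Fin.prod_univ_castSucc]
  simp only [Fin.snoc_castSucc, Fin.snoc_last]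
  have ha : ∀ t : Fin n, (fun i => (Fin.snoc sa a' : Fin (n + 1) → Sa)
      (Fin.castLE (Fin.castSucc t).isLt i)) = fun i => sa (Fin.castLE t.isLt i) := by
    intro t; funext i
    exact Fin.snoc_castSucc (α := fun _ => Sa) a' sa (Fin.castLE t.isLt i)
  have hb : ∀ t : Fin n, (fun i => (Fin.snoc sb b' : Fin (n + 1) → Sb)
      (Fin.castLE (Fin.castSucc t).isLt i)) = fun i => sb (Fin.castLE t.isLt i) := by
    intro t; funext i
    exact Fin.snoc_castSucc (α := fun _ => Sb) b' sb (Fin.castLE t.isLt i)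
  congr 1
  refine Finset.prod_congr rfl fun t _ => ?_
  congr 1
  have h1 : eA (↑(Fin.castSucc t)) (fun i => (Fin.snoc sa a' : Fin (n + 1) → Sa)
      (Fin.castLE (Fin.castSucc t).isLt i)) wa = eA t (fun i => sa (Fin.castLE t.isLt i)) wa :=
    congrArg (fun f => eA t f wa) (ha t)
  have h2 : eB (↑(Fin.castSucc t)) (fun i => (Fin.snoc sb b' : Fin (n + 1) → Sb)
      (Fin.castLE (Fin.castSucc t).isLt i)) wb = eB t (fun i => sb (Fin.castLE t.isLt i)) wb :=
    congrArg (fun f => eB t f wb) (hb t)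
  rw [h1, h2]

/-- Strategy of encoder `a` at time `n`. -/
def tauA (n : ℕ) (wa : Wa) (sa : Fin n → Sa) : Sa → Xa := fun a => eA n (Fin.snoc sa a) wa

lemma pw_snoc (n : ℕ) (wa : Wa) (wb : Wb) (s : Fin n → S) (y : Fin n → Y) (s' : S) (y' : Y) :
    pw M eA eB (n + 1) wa wb (Fin.snoc s s') (Fin.snoc y y') =
    ∑ sa, ∑ sb, jp M eA eB n wa wb s sa sb y *
      kk M (tauA eA n wa sa) (tauA eB n wb sb) s' y' := by
  unfold pw
  rw [sum_snoc]
  refine Finset.sum_congr rfl fun sa _ => ?_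
  have : ∀ a', ∑ sb, jp M eA eB (n + 1) wa wb (Fin.snoc s s') (Fin.snoc sa a') sb (Fin.snoc y y') =
     ∑ sb : Fin n → Sb, ∑ b', jp M eA eB n wa wb s sa sb y * (M.PS s' * M.Qa s' a' * M.Qb s' b' *
      M.chan (eA n (Fin.snoc sa a') wa) (eB n (Fin.snoc sb b') wb) s' y') := by
    intro a'
    rw [sum_snoc]
    simp only [jp_snoc]
  simp only [this]
  rw [Finset.sum_comm]
  refine Finset.sum_congr rfl fun sb _ => ?_
  simp only [← Finset.mul_sum]
  congr 1
  simp only [kk, stratKernel, Finset.mul_sum, tauA]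
  refine Finset.sum_congr rfl fun a _ => Finset.sum_congr rfl fun b _ => by ring

lemma jp_sum_y (n : ℕ) (wa : Wa) (wb : Wb)
    (s : Fin n → S) (sa : Fin n → Sa) (sb : Fin n → Sb) :
    ∑ y, jp M eA eB n wa wb s sa sb y =
      (∏ t, M.PS (s t)) * (∏ t, M.Qa (s t) (sa t)) * (∏ t, M.Qb (s t) (sb t)) := by
  unfold jp
  rw [sum_pi_prod (fun t y => M.PS (s t) * M.Qa (s t) (sa t) * M.Qb (s t) (sb t) *
    M.chan (eA t (fun i => sa (Fin.castLE t.isLt i)) wa)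
      (eB t (fun i => sb (Fin.castLE t.isLt i)) wb) (s t) y)]
  simp only [← Finset.mul_sum, (M.chan_pmf _ _ _).2, mul_one, Finset.prod_mul_distrib]

lemma pw_nonneg (n : ℕ) (wa : Wa) (wb : Wb) (s : Fin n → S) (y : Fin n → Y) :
    0 ≤ pw M eA eB n wa wb s y :=
  Finset.sum_nonneg fun _ _ => Finset.sum_nonneg fun _ _ => jp_nonneg M eA eB n wa wb s _ _ y

lemma qaprod_pmf (n : ℕ) (s : Fin n → S) :
    isPMF (fun sa : Fin n → Sa => ∏ t, M.Qa (s t) (sa t)) :=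
  ⟨fun sa => Finset.prod_nonneg fun t _ => (M.Qa_pmf _).1 _, by
    rw [sum_pi_prod (fun t a => M.Qa (s t) a)]; simp [(M.Qa_pmf _).2]⟩

lemma qbprod_pmf (n : ℕ) (s : Fin n → S) :
    isPMF (fun sb : Fin n → Sb => ∏ t, M.Qb (s t) (sb t)) :=
  ⟨fun sb => Finset.prod_nonneg fun t _ => (M.Qb_pmf _).1 _, by
    rw [sum_pi_prod (fun t a => M.Qb (s t) a)]; simp [(M.Qb_pmf _).2]⟩

lemma psprod_pmf (n : ℕ) :
    isPMF (fun s : Fin n → S => ∏ t, M.PS (s t)) :=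
  ⟨fun sb => Finset.prod_nonneg fun t _ => M.PS_pmf.1 _, by
    rw [sum_pi_prod (fun t a => M.PS a)]; simp [M.PS_pmf.2]⟩

lemma pw_sum (n : ℕ) (wa : Wa) (wb : Wb) :
    ∑ s, ∑ y, pw M eA eB n wa wb s y = 1 := by
  unfold pw
  have : ∀ s, ∑ y, ∑ sa, ∑ sb, jp M eA eB n wa wb s sa sb y = ∏ t, M.PS (s t) := by
    intro s
    rw [Finset.sum_comm]
    have : ∀ sa, ∑ y, ∑ sb, jp M eA eB n wa wb s sa sb y =
        (∏ t, M.PS (s t)) * (∏ t, M.Qa (s t) (sa t)) := by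
      intro sa
      rw [Finset.sum_comm]
      simp only [jp_sum_y, ← Finset.mul_sum]
      rw [(qbprod_pmf M n s).2, mul_one]
    simp only [this, ← Finset.mul_sum]
    rw [(qaprod_pmf M n s).2, mul_one]
  simp only [this]
  exact (psprod_pmf M n).2

end conv

section conv2

variable {Wa Wb : Type} [Fintype Wa] [Fintype Wb] [Nonempty Wa] [Nonempty Wb]
variable (M : FSMAC S Sa Sb Xa Xb Y) (eA : (t : ℕ) → (Fin (t + 1) → Sa) → Wa → Xa)
    (eB : (t : ℕ) → (Fin (t + 1) → Sb) → Wb → Xb)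

/-- Law of the strategy of user `a` at time `n` given the past states. -/
def polA (n : ℕ) (s : Fin n → S) : (Sa → Xa) → ℝ :=
  push (tauA eA n) (fun sa : Fin n → Sa => ∏ t, M.Qa (s t) (sa t))

/-- Law of the strategy of user `b` at time `n` given the past states. -/
def polB (n : ℕ) (s : Fin n → S) : (Sb → Xb) → ℝ :=
  push (tauA eB n) (fun sb : Fin n → Sb => ∏ t, M.Qb (s t) (sb t))

lemma polA_pmf (n : ℕ) (s : Fin n → S) : isPMF (polA M eA n s) := push_pmf _ _ (qaprod_pmf M n s)
lemma polB_pmf (n : ℕ) (s : Fin n → S) : isPMF (polB M eB n s) := push_pmf _ _ (qbprod_pmf M n s)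

lemma conv_ac (n : ℕ) (wa : Wa) (wb : Wb)
    (s : Fin n → S) (sa : Fin n → Sa) (sb : Fin n → Sb) (y : Fin n → Y) (s' : S) (y' : Y)
    (h : rr M (polA M eA n s) (polB M eB n s) s' y' = 0) :
    jp M eA eB n wa wb s sa sb y * kk M (tauA eA n wa sa) (tauA eB n wb sb) s' y' = 0 := by
  have h1 := rr_ge M (polA_pmf M eA n s).1 (polB_pmf M eB n s).1 (tauA eA n wa sa)
    (tauA eB n wb sb) s' y'
  rw [h] at h1
  have h2 : polA M eA n s (tauA eA n wa sa) * polB M eB n s (tauA eB n wb sb) *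
      kk M (tauA eA n wa sa) (tauA eB n wb sb) s' y' = 0 :=
    le_antisymm h1 (mul_nonneg (mul_nonneg ((polA_pmf M eA n s).1 _) ((polB_pmf M eB n s).1 _))
      (kk_nonneg M _ _ _ _))
  rcases mul_eq_zero.1 h2 with h3 | h3
  · have hj : jp M eA eB n wa wb s sa sb y = 0 := by
      have hsplit : jp M eA eB n wa wb s sa sb y =
        (∏ t, M.PS (s t)) * (∏ t, M.Qa (s t) (sa t)) * (∏ t, M.Qb (s t) (sb t)) *
        ∏ t : Fin n, M.chan (eA t (fun i => sa (Fin.castLE t.isLt i)) wa)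
          (eB t (fun i => sb (Fin.castLE t.isLt i)) wb) (s t) (y t) := by
        simp only [jp, Finset.prod_mul_distrib]
      rw [hsplit]
      rcases mul_eq_zero.1 h3 with h4 | h4
      · have := push_zero (tauA eA n) _ (qaprod_pmf M n s).1 wa sa h4
        rw [this]; ring
      · have := push_zero (tauA eB n) _ (qbprod_pmf M n s).1 wb sb h4
        rw [this]; ring
    rw [hj, zero_mul]
  · rw [h3, mul_zero]

/-- single-letter step of the converse -/
lemma conv_step (n : ℕ) (wa : Wa) (wb : Wb) (Q : (Fin n → S) → (Fin n → Y) → ℝ)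
    (hac : ∀ wa wb s y, Q s y = 0 → pw M eA eB n wa wb s y = 0)
    (s : Fin n → S) (y : Fin n → Y) (s' : S) (y' : Y) :
    pw M eA eB (n + 1) wa wb (Fin.snoc s s') (Fin.snoc y y') *
      Real.log (pw M eA eB (n + 1) wa wb (Fin.snoc s s') (Fin.snoc y y') /
        (Q s y * rr M (polA M eA n s) (polB M eB n s) s' y')) ≤
    pw M eA eB (n + 1) wa wb (Fin.snoc s s') (Fin.snoc y y') *
      Real.log (pw M eA eB n wa wb s y / Q s y) +
    ∑ sa, ∑ sb, jp M eA eB n wa wb s sa sb y *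
      (kk M (tauA eA n wa sa) (tauA eB n wb sb) s' y' *
        Real.log (kk M (tauA eA n wa sa) (tauA eB n wb sb) s' y' /
          rr M (polA M eA n s) (polB M eB n s) s' y')) := by
  set r := rr M (polA M eA n s) (polB M eB n s) s' y' with hr
  have hr0 : 0 ≤ r := rr_nonneg M (polA_pmf M eA n s).1 (polB_pmf M eB n s).1 s' y'
  have hls := log_sum_ineq (U := (Fin n → Sa) × (Fin n → Sb))
    (fun u => jp M eA eB n wa wb s u.1 u.2 y * kk M (tauA eA n wa u.1) (tauA eB n wb u.2) s' y')
    (fun u => jp M eA eB n wa wb s u.1 u.2 y * r)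
    (fun u => mul_nonneg (jp_nonneg _ _ _ _ _ _ _ _ _ _) (kk_nonneg _ _ _ _ _))
    (fun u => mul_nonneg (jp_nonneg _ _ _ _ _ _ _ _ _ _) hr0)
    (fun u h => by
      rcases mul_eq_zero.1 h with h | h
      · rw [h, zero_mul]
      · exact conv_ac M eA eB n wa wb s u.1 u.2 y s' y' h)
  simp only [Fintype.sum_prod_type, ← Finset.sum_mul] at hls
  rw [← pw_snoc] at hls
  have hpw : ∑ sa, ∑ sb, jp M eA eB n wa wb s sa sb y = pw M eA eB n wa wb s y := rfl
  rw [hpw] at hls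
  set p' := pw M eA eB (n + 1) wa wb (Fin.snoc s s') (Fin.snoc y y') with hp'
  have hR : ∑ sa, ∑ sb, jp M eA eB n wa wb s sa sb y *
      kk M (tauA eA n wa sa) (tauA eB n wb sb) s' y' *
        Real.log (jp M eA eB n wa wb s sa sb y * kk M (tauA eA n wa sa) (tauA eB n wb sb) s' y' /
          (jp M eA eB n wa wb s sa sb y * r)) =
      ∑ sa, ∑ sb, jp M eA eB n wa wb s sa sb y *
      (kk M (tauA eA n wa sa) (tauA eB n wb sb) s' y' *
        Real.log (kk M (tauA eA n wa sa) (tauA eB n wb sb) s' y' / r)) := by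
    refine Finset.sum_congr rfl fun sa _ => Finset.sum_congr rfl fun sb _ => ?_
    by_cases h : jp M eA eB n wa wb s sa sb y = 0
    · simp [h]
    · rw [mul_div_mul_left _ _ h]; ring
  rw [hR] at hls
  refine le_trans (le_of_eq ?_) (add_le_add_right hls _)
  by_cases h0 : p' = 0
  · simp [h0]
  · have hp : pw M eA eB n wa wb s y ≠ 0 := by
      intro h
      apply h0
      rw [hp', pw_snoc]
      have h1 := (Finset.sum_eq_zero_iff_of_nonneg (fun sa _ =>
        Finset.sum_nonneg fun sb _ => jp_nonneg M eA eB n wa wb s sa sb y)).1 h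
      refine Finset.sum_eq_zero fun sa hsa => Finset.sum_eq_zero fun sb hsb => ?_
      have h2 := (Finset.sum_eq_zero_iff_of_nonneg (fun sb _ =>
        jp_nonneg M eA eB n wa wb s sa sb y)).1 (h1 sa hsa) sb hsb
      rw [h2, zero_mul]
    have hrn : r ≠ 0 := by
      intro h
      apply h0
      rw [hp', pw_snoc]
      exact Finset.sum_eq_zero fun sa hsa => Finset.sum_eq_zero fun sb hsb =>
        conv_ac M eA eB n wa wb s sa sb y s' y' h
    have hQ : Q s y ≠ 0 := fun h => hp (hac wa wb s y h)
    rw [← mul_add, Real.log_div h0 (mul_ne_zero hQ hrn), Real.log_mul hQ hrn,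
      Real.log_div hp hQ, Real.log_div h0 (mul_ne_zero hp hrn), Real.log_mul hp hrn]
    ring

lemma pw_marg (n : ℕ) (wa : Wa) (wb : Wb) (s : Fin n → S) (y : Fin n → Y) :
    ∑ s', ∑ y', pw M eA eB (n + 1) wa wb (Fin.snoc s s') (Fin.snoc y y') =
      pw M eA eB n wa wb s y := by
  simp only [pw_snoc]
  have h1 : ∀ s', ∑ y', ∑ sa, ∑ sb, jp M eA eB n wa wb s sa sb y *
      kk M (tauA eA n wa sa) (tauA eB n wb sb) s' y' = ∑ sa, ∑ sb, ∑ y', jp M eA eB n wa wb s sa sb y *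
      kk M (tauA eA n wa sa) (tauA eB n wb sb) s' y' := by
    intro s'
    rw [Finset.sum_comm]
    exact Finset.sum_congr rfl fun sa _ => Finset.sum_comm
  simp only [h1]
  rw [Finset.sum_comm]
  refine Finset.sum_congr rfl fun sa _ => ?_
  rw [Finset.sum_comm]
  refine Finset.sum_congr rfl fun sb _ => ?_
  simp only [← Finset.mul_sum]
  rw [kk_sum, mul_one]

lemma conv_rate (C : ℝ) (hC : ∀ πa πb, isPMF πa → isPMF πb → Isum M πa πb ≤ C) (n : ℕ) :
    ∑ wa, ∑ wb, ∑ s : Fin n → S, ∑ y : Fin n → Y, ∑ s', ∑ y',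
      ∑ sa, ∑ sb, jp M eA eB n wa wb s sa sb y *
      (kk M (tauA eA n wa sa) (tauA eB n wb sb) s' y' *
        Real.log (kk M (tauA eA n wa sa) (tauA eB n wb sb) s' y' /
          rr M (polA M eA n s) (polB M eB n s) s' y')) ≤
    Fintype.card Wa * Fintype.card Wb * (C * Real.log 2) := by
  set G : (Fin n → S) → (Sa → Xa) → (Sb → Xb) → ℝ := fun s ta tb =>
    ∑ s', ∑ y', kk M ta tb s' y' *
        Real.log (kk M ta tb s' y' / rr M (polA M eA n s) (polB M eB n s) s' y') with hG
  have e1 : ∀ wa wb (s : Fin n → S), ∑ y : Fin n → Y, ∑ s', ∑ y',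
      ∑ sa, ∑ sb, jp M eA eB n wa wb s sa sb y *
      (kk M (tauA eA n wa sa) (tauA eB n wb sb) s' y' *
        Real.log (kk M (tauA eA n wa sa) (tauA eB n wb sb) s' y' /
          rr M (polA M eA n s) (polB M eB n s) s' y')) =
      (∏ t, M.PS (s t)) * ∑ sa, (∏ t, M.Qa (s t) (sa t)) * ∑ sb, (∏ t, M.Qb (s t) (sb t)) *
        G s (tauA eA n wa sa) (tauA eB n wb sb) := by
    intro wa wb s
    have f1 : ∀ y : Fin n → Y, ∑ s', ∑ y',
      ∑ sa, ∑ sb, jp M eA eB n wa wb s sa sb y *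
      (kk M (tauA eA n wa sa) (tauA eB n wb sb) s' y' *
        Real.log (kk M (tauA eA n wa sa) (tauA eB n wb sb) s' y' /
          rr M (polA M eA n s) (polB M eB n s) s' y')) =
      ∑ sa, ∑ sb, jp M eA eB n wa wb s sa sb y * G s (tauA eA n wa sa) (tauA eB n wb sb) := by
      intro y
      simp only [hG, Finset.mul_sum]
      have : ∀ s', ∑ y', ∑ sa, ∑ sb, jp M eA eB n wa wb s sa sb y *
      (kk M (tauA eA n wa sa) (tauA eB n wb sb) s' y' *
        Real.log (kk M (tauA eA n wa sa) (tauA eB n wb sb) s' y' /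
          rr M (polA M eA n s) (polB M eB n s) s' y')) =
          ∑ sa, ∑ sb, ∑ y', jp M eA eB n wa wb s sa sb y *
      (kk M (tauA eA n wa sa) (tauA eB n wb sb) s' y' *
        Real.log (kk M (tauA eA n wa sa) (tauA eB n wb sb) s' y' /
          rr M (polA M eA n s) (polB M eB n s) s' y')) := by
        intro s'
        rw [Finset.sum_comm]
        exact Finset.sum_congr rfl fun sa _ => Finset.sum_comm
      simp only [this]
      rw [Finset.sum_comm]
      refine Finset.sum_congr rfl fun sa _ => ?_
      rw [Finset.sum_comm]
    simp only [f1]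
    rw [Finset.sum_comm, Finset.mul_sum]
    refine Finset.sum_congr rfl fun sa _ => ?_
    rw [Finset.sum_comm, Finset.mul_sum, Finset.mul_sum]
    refine Finset.sum_congr rfl fun sb _ => ?_
    rw [← Finset.sum_mul, jp_sum_y]
    ring
  simp only [e1]
  have e2 : ∑ wa, ∑ wb, ∑ s : Fin n → S, (∏ t, M.PS (s t)) * ∑ sa, (∏ t, M.Qa (s t) (sa t)) *
      ∑ sb, (∏ t, M.Qb (s t) (sb t)) * G s (tauA eA n wa sa) (tauA eB n wb sb) =
      ∑ s : Fin n → S, (∏ t, M.PS (s t)) * ∑ wa, ∑ sa, (∏ t, M.Qa (s t) (sa t)) *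
      ∑ wb, ∑ sb, (∏ t, M.Qb (s t) (sb t)) * G s (tauA eA n wa sa) (tauA eB n wb sb) := by
    have : ∀ wa, ∑ wb, ∑ s : Fin n → S, (∏ t, M.PS (s t)) * ∑ sa, (∏ t, M.Qa (s t) (sa t)) *
      ∑ sb, (∏ t, M.Qb (s t) (sb t)) * G s (tauA eA n wa sa) (tauA eB n wb sb) =
      ∑ s : Fin n → S, (∏ t, M.PS (s t)) * ∑ sa, (∏ t, M.Qa (s t) (sa t)) *
      ∑ wb, ∑ sb, (∏ t, M.Qb (s t) (sb t)) * G s (tauA eA n wa sa) (tauA eB n wb sb) := by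
      intro wa
      rw [Finset.sum_comm]
      refine Finset.sum_congr rfl fun s _ => ?_
      rw [← Finset.mul_sum, Finset.sum_comm]
      simp only [← Finset.mul_sum]
    simp only [this]
    rw [Finset.sum_comm]
    simp only [← Finset.mul_sum]
  rw [e2]
  have hca : (Fintype.card Wa : ℝ) ≠ 0 := by exact_mod_cast Fintype.card_ne_zero
  have hcb : (Fintype.card Wb : ℝ) ≠ 0 := by exact_mod_cast Fintype.card_ne_zero
  have e3 : ∀ s : Fin n → S, ∑ wa, ∑ sa, (∏ t, M.Qa (s t) (sa t)) *
      ∑ wb, ∑ sb, (∏ t, M.Qb (s t) (sb t)) * G s (tauA eA n wa sa) (tauA eB n wb sb) =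
      Fintype.card Wa * Fintype.card Wb * (Isum M (polA M eA n s) (polB M eB n s) * Real.log 2) := by
    intro s
    have g1 : ∀ ta, ∑ wb, ∑ sb, (∏ t, M.Qb (s t) (sb t)) * G s ta (tauA eB n wb sb) =
        Fintype.card Wb * ∑ tb, polB M eB n s tb * G s ta tb := by
      intro ta
      rw [polB, push_sum, mul_inv_cancel_left₀ hcb]
    have g2 := push_sum (tauA eA n) (fun sa : Fin n → Sa => ∏ t, M.Qa (s t) (sa t))
      (fun ta => Fintype.card Wb * ∑ tb, polB M eB n s tb * G s ta tb)
    simp only [g1]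
    rw [eq_comm, inv_mul_eq_iff_eq_mul₀ hca] at g2
    rw [g2, Isum_eq M (polA_pmf M eA n s) (polB_pmf M eB n s), mul_assoc]
    congr 1
    rw [Finset.mul_sum]
    refine Finset.sum_congr rfl fun ta _ => ?_
    rw [Finset.mul_sum, Finset.mul_sum, Finset.mul_sum]
    refine Finset.sum_congr rfl fun tb _ => ?_
    simp only [hG, Finset.mul_sum]
    refine Finset.sum_congr rfl fun s' _ => Finset.sum_congr rfl fun y' _ => ?_
    rw [polA]
    ring
  simp only [e3]
  have l2 := Real.log_pos one_lt_two
  calc _ ≤ ∑ s : Fin n → S, (∏ t, M.PS (s t)) *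
        (Fintype.card Wa * Fintype.card Wb * (C * Real.log 2)) := by
        refine Finset.sum_le_sum fun s _ => mul_le_mul_of_nonneg_left ?_ ((psprod_pmf M n).1 s)
        refine mul_le_mul_of_nonneg_left ?_ (by positivity)
        exact mul_le_mul_of_nonneg_right (hC _ _ (polA_pmf M eA n s) (polB_pmf M eB n s)) l2.le
    _ = _ := by rw [← Finset.sum_mul, (psprod_pmf M n).2, one_mul]

lemma conv_ind (C : ℝ) (hC : ∀ πa πb, isPMF πa → isPMF πb → Isum M πa πb ≤ C) (n : ℕ) :
    ∃ Q : (Fin n → S) → (Fin n → Y) → ℝ, (∀ s y, 0 ≤ Q s y) ∧ (∑ s, ∑ y, Q s y = 1) ∧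
      (∀ wa wb s y, Q s y = 0 → pw M eA eB n wa wb s y = 0) ∧
      ∑ wa, ∑ wb, ∑ s, ∑ y, pw M eA eB n wa wb s y *
        Real.log (pw M eA eB n wa wb s y / Q s y) ≤
      Fintype.card Wa * Fintype.card Wb * (n * (C * Real.log 2)) := by
  induction n with
  | zero =>
    refine ⟨fun _ _ => 1, fun _ _ => zero_le_one, by simp, fun _ _ _ _ h => absurd h one_ne_zero, ?_⟩
    simp [pw, jp]
  | succ n ih =>
    obtain ⟨Q, hQ0, hQ1, hac, hle⟩ := ih
    refine ⟨fun s y => Q (Fin.init s) (Fin.init y) *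
      rr M (polA M eA n (Fin.init s)) (polB M eB n (Fin.init s)) (s (Fin.last n)) (y (Fin.last n)),
      ?_, ?_, ?_, ?_⟩
    · intro s y
      exact mul_nonneg (hQ0 _ _) (rr_nonneg M (polA_pmf M eA n _).1 (polB_pmf M eB n _).1 _ _)
    · rw [sum_snoc]
      simp only [sum_snoc, Fin.init_snoc, Fin.snoc_last]
      rw [← hQ1]
      refine Finset.sum_congr rfl fun s _ => ?_
      rw [Finset.sum_comm]
      refine Finset.sum_congr rfl fun y _ => ?_
      simp only [← Finset.mul_sum]
      rw [rr_sum M (polA_pmf M eA n s) (polB_pmf M eB n s), mul_one]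
    · intro wa wb s y h
      rw [← Fin.snoc_init_self s, ← Fin.snoc_init_self y, pw_snoc]
      refine Finset.sum_eq_zero fun sa hsa => Finset.sum_eq_zero fun sb hsb => ?_
      rcases mul_eq_zero.1 h with h | h
      · have h0 := hac wa wb _ _ h
        have h1 := (Finset.sum_eq_zero_iff_of_nonneg (fun sa _ =>
          Finset.sum_nonneg fun sb _ => jp_nonneg M eA eB n wa wb _ sa sb _)).1 h0 sa hsa
        have h2 := (Finset.sum_eq_zero_iff_of_nonneg (fun sb _ =>
          jp_nonneg M eA eB n wa wb _ sa sb _)).1 h1 sb hsb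
        rw [h2, zero_mul]
      · exact conv_ac M eA eB n wa wb _ sa sb _ _ _ h
    · simp only [sum_snoc, Fin.init_snoc, Fin.snoc_last]
      have step : ∀ wa wb (s : Fin n → S), ∑ s', ∑ y : Fin n → Y, ∑ y',
          pw M eA eB (n + 1) wa wb (Fin.snoc s s') (Fin.snoc y y') *
          Real.log (pw M eA eB (n + 1) wa wb (Fin.snoc s s') (Fin.snoc y y') /
          (Q s y * rr M (polA M eA n s) (polB M eB n s) s' y')) ≤
          (∑ y : Fin n → Y, pw M eA eB n wa wb s y * Real.log (pw M eA eB n wa wb s y / Q s y)) +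
          ∑ y : Fin n → Y, ∑ s', ∑ y', ∑ sa, ∑ sb, jp M eA eB n wa wb s sa sb y *
            (kk M (tauA eA n wa sa) (tauA eB n wb sb) s' y' *
              Real.log (kk M (tauA eA n wa sa) (tauA eB n wb sb) s' y' /
                rr M (polA M eA n s) (polB M eB n s) s' y')) := by
        intro wa wb s
        rw [Finset.sum_comm, ← Finset.sum_add_distrib]
        refine Finset.sum_le_sum fun y _ => ?_
        rw [← pw_marg, Finset.sum_mul, ← Finset.sum_add_distrib]
        refine Finset.sum_le_sum fun s' _ => ?_
        rw [Finset.sum_mul, ← Finset.sum_add_distrib]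
        refine Finset.sum_le_sum fun y' _ => ?_
        rw [pw_marg]
        exact conv_step M eA eB n wa wb Q hac s y s' y'
      refine (Finset.sum_le_sum fun wa _ => Finset.sum_le_sum fun wb _ =>
        Finset.sum_le_sum fun s _ => step wa wb s).trans ?_
      simp only [Finset.sum_add_distrib]
      have := conv_rate M eA eB C hC n
      push_cast
      linarith

end conv2

section conv3

variable (M : FSMAC S Sa Sb Xa Xb Y)

lemma errProb_eq {n Ma Mb : ℕ} (C : Code M n (Fin Ma) (Fin Mb))
    (eA : (t : ℕ) → (Fin (t + 1) → Sa) → Fin Ma → Xa)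
    (eB : (t : ℕ) → (Fin (t + 1) → Sb) → Fin Mb → Xb)
    (hA : ∀ t : Fin n, eA t = C.encA t) (hB : ∀ t : Fin n, eB t = C.encB t) :
    errProb M C = (Ma : ℝ)⁻¹ * (Mb : ℝ)⁻¹ * ∑ wa, ∑ wb, ∑ s, ∑ y,
      if C.dec s y ≠ (wa, wb) then pw M eA eB n wa wb s y else 0 := by
  unfold errProb codePr
  simp only [Finset.mul_sum]
  refine Finset.sum_congr rfl fun wa _ => Finset.sum_congr rfl fun wb _ =>
    Finset.sum_congr rfl fun s _ => ?_
  have hcp : ∀ sa sb y, codeProb M C wa wb s sa sb y =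
      (Ma : ℝ)⁻¹ * (Mb : ℝ)⁻¹ * jp M eA eB n wa wb s sa sb y := by
    intro sa sb y
    simp only [codeProb, jp, Fintype.card_fin, hA, hB]
  simp only [hcp]
  have h1 : ∀ sa : Fin n → Sa, ∀ F : (Fin n → Sb) → (Fin n → Y) → ℝ, ∑ sb, ∑ y, F sb y = ∑ y, ∑ sb, F sb y :=
    fun _ _ => Finset.sum_comm
  rw [Finset.sum_congr rfl fun sa _ => h1 sa _, Finset.sum_comm]
  refine Finset.sum_congr rfl fun y _ => ?_
  by_cases h : C.dec s y = (wa, wb)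
  · simp [h]
  · simp [h, pw, Finset.mul_sum]

lemma converse_code [Nonempty Xa] [Nonempty Xb] (c : ℝ)
    (hC : ∀ πa πb, isPMF πa → isPMF πb → Isum M πa πb ≤ c)
    {n Ma Mb : ℕ} (hMa : 0 < Ma) (hMb : 0 < Mb) (C : Code M n (Fin Ma) (Fin Mb)) :
    (1 - errProb M C) * (Real.logb 2 Ma + Real.logb 2 Mb) - 1 / Real.log 2 ≤ n * c := by
  classical
  have : Nonempty (Fin Ma) := ⟨⟨0, hMa⟩⟩
  have : Nonempty (Fin Mb) := ⟨⟨0, hMb⟩⟩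
  set eA : (t : ℕ) → (Fin (t + 1) → Sa) → Fin Ma → Xa := fun t h w =>
    if ht : t < n then C.encA ⟨t, ht⟩ h w else Classical.arbitrary Xa with heA
  set eB : (t : ℕ) → (Fin (t + 1) → Sb) → Fin Mb → Xb := fun t h w =>
    if ht : t < n then C.encB ⟨t, ht⟩ h w else Classical.arbitrary Xb with heB
  have he := errProb_eq M C eA eB (fun t => by funext h w; simp [heA])
    (fun t => by funext h w; simp [heB])
  obtain ⟨Q, hQ0, hQ1, hac, hle⟩ := conv_ind M eA eB c hC n
  have hf := fano_bound (W := Fin Ma × Fin Mb) (Z := (Fin n → S) × (Fin n → Y))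
    (fun w z => pw M eA eB n w.1 w.2 z.1 z.2) (fun z => Q z.1 z.2)
    (fun w z => pw_nonneg _ _ _ _ _ _ _ _)
    (fun w => by rw [Fintype.sum_prod_type]; exact pw_sum M eA eB n w.1 w.2)
    ⟨fun z => hQ0 _ _, by rw [Fintype.sum_prod_type]; exact hQ1⟩
    (fun w z h => hac _ _ _ _ h) (fun z => C.dec z.1 z.2)
  simp only [Fintype.sum_prod_type, Fintype.card_prod, Fintype.card_fin, Nat.cast_mul] at hf hle
  set E := ∑ wa, ∑ wb, ∑ s, ∑ y,
      if C.dec s y ≠ (wa, wb) then pw M eA eB n wa wb s y else 0 with hE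
  have hMa' : (0 : ℝ) < Ma := by exact_mod_cast hMa
  have hMb' : (0 : ℝ) < Mb := by exact_mod_cast hMb
  have hf2 : ((Ma : ℝ) * Mb - E) * Real.log (Ma * Mb) - Ma * Mb ≤ Ma * Mb * (n * (c * Real.log 2)) := by
    exact hf.trans hle
  have l2 := Real.log_pos one_lt_two
  have hEe : E = Ma * Mb * errProb M C := by rw [he]; field_simp
  rw [hEe] at hf2
  have h3 : (Ma * Mb : ℝ) * ((1 - errProb M C) * Real.log (Ma * Mb) - 1) ≤
      Ma * Mb * (n * (c * Real.log 2)) := by linarith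
  have h4 := le_of_mul_le_mul_left h3 (by positivity)
  rw [Real.log_mul hMa'.ne' hMb'.ne'] at h4
  have h5 : ((1 - errProb M C) * (Real.logb 2 Ma + Real.logb 2 Mb) - 1 / Real.log 2) * Real.log 2
      = (1 - errProb M C) * (Real.log Ma + Real.log Mb) - 1 := by
    simp only [Real.logb]; field_simp
  refine le_of_mul_le_mul_right ?_ l2
  rw [h5]
  linarith

lemma state_nonempty (M : FSMAC S Sa Sb Xa Xb Y) : Nonempty S := by
  by_contra h
  rw [not_nonempty_iff] at h
  have := M.PS_pmf.2
  simp at this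

lemma obsA_nonempty (M : FSMAC S Sa Sb Xa Xb Y) : Nonempty Sa := by
  obtain ⟨s⟩ := state_nonempty M
  by_contra h
  rw [not_nonempty_iff] at h
  have := (M.Qa_pmf s).2
  simp at this

lemma obsB_nonempty (M : FSMAC S Sa Sb Xa Xb Y) : Nonempty Sb := by
  obtain ⟨s⟩ := state_nonempty M
  by_contra h
  rw [not_nonempty_iff] at h
  have := (M.Qb_pmf s).2
  simp at this

lemma out_nonempty (M : FSMAC S Sa Sb Xa Xb Y) [Nonempty Xa] [Nonempty Xb] : Nonempty Y := by
  obtain ⟨s⟩ := state_nonempty M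
  by_contra h
  rw [not_nonempty_iff] at h
  have := (M.chan_pmf (Classical.arbitrary Xa) (Classical.arbitrary Xb) s).2
  simp at this

lemma converse [Nonempty Xa] [Nonempty Xb] (c : ℝ)
    (hC : ∀ πa πb, isPMF πa → isPMF πb → Isum M πa πb ≤ c) (Ra Rb : ℝ)
    (h : Achievable M Ra Rb) : Ra + Rb ≤ c := by
  obtain ⟨hRa, hRb, h⟩ := h
  obtain ⟨s⟩ := state_nonempty M
  obtain ⟨y⟩ := out_nonempty M
  have l2 := Real.log_pos one_lt_two
  have key : ∀ ε : ℝ, 0 < ε → ε < 1 → (1 - ε) * (Ra + Rb) ≤ c := by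
    intro ε hε hε1
    obtain ⟨N, hN⟩ := h ε hε
    refine le_of_forall_pos_le_add fun δ hδ => ?_
    obtain ⟨k, hk⟩ := exists_nat_gt (1 / Real.log 2 / δ)
    set n := max N (k + 1) with hn
    have hn0 : (0 : ℝ) < n := by
      have : 0 < n := lt_of_lt_of_le (Nat.succ_pos k) (le_max_right _ _)
      exact_mod_cast this
    obtain ⟨Ma, Mb, C, h1, h2, h3⟩ := hN n (le_max_left _ _)
    have hMa : 0 < Ma := (C.dec (fun _ => s) (fun _ => y)).1.pos
    have hMb : 0 < Mb := (C.dec (fun _ => s) (fun _ => y)).2.pos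
    have h4 := converse_code M c hC hMa hMb C
    rw [le_div_iff₀ hn0] at h1 h2
    have h5 : (1 - ε) * ((Ra + Rb) * n) ≤ (1 - errProb M C) * (Real.logb 2 Ma + Real.logb 2 Mb) := by
      refine mul_le_mul (by linarith) (by linarith) (by positivity) (by linarith)
    have hkn : (k : ℝ) ≤ n := by
      have : k ≤ n := (Nat.le_succ k).trans (le_max_right _ _)
      exact_mod_cast this
    have h6 : 1 / Real.log 2 ≤ δ * n := by
      rw [div_lt_iff₀ hδ] at hk
      nlinarith
    refine le_of_mul_le_mul_right ?_ hn0
    linarith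
  by_contra hcon
  push Not at hcon
  rcases le_or_gt (Ra + Rb) 0 with h0 | h0
  · have h1 := key (1/2) (by norm_num) (by norm_num)
    have : Ra + Rb = 0 := le_antisymm h0 (add_nonneg hRa hRb)
    rw [this] at h1 hcon
    linarith
  · set d := Ra + Rb - c with hd
    have hd0 : 0 < d := by linarith
    have h1 := key (min (1/2) (d / (2 * (Ra + Rb)))) (by positivity)
      (lt_of_le_of_lt (min_le_left _ _) (by norm_num))
    have h2 : min (1/2) (d / (2 * (Ra + Rb))) * (Ra + Rb) ≤ d / 2 := by
      calc _ ≤ d / (2 * (Ra + Rb)) * (Ra + Rb) :=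
            mul_le_mul_of_nonneg_right (min_le_right _ _) h0.le
        _ = d / 2 := by field_simp
    linarith

/-- No pmf on an empty type. -/
lemma no_pmf {α : Type} [Fintype α] [IsEmpty α] (p : α → ℝ) : ¬ isPMF p := by
  intro h
  have := h.2
  simp at this

end conv3

/-! ### Achievability -/

lemma cb_one {A : Type} [Fintype A] (p : A → ℝ) (hp : ∑ a, p a = 1) {m : ℕ} (w : Fin m)
    (f : A → ℝ) : ∑ c : Fin m → A, (∏ w', p (c w')) * f (c w) = ∑ a, p a * f a := by
  classical
  have h1 : ∀ c : Fin m → A, (∏ w', p (c w')) * f (c w) =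
      ∑ a, f a * ∏ w', (p (c w') * if w' = w then (if c w' = a then 1 else 0) else 1) := by
    intro c
    simp only [Finset.prod_mul_distrib, Finset.prod_ite_eq', Finset.mem_univ, if_true]
    simp [mul_comm]
  simp only [h1]
  rw [Finset.sum_comm]
  refine Finset.sum_congr rfl fun a _ => ?_
  rw [← Finset.mul_sum, sum_pi_prod (fun w' x => p x * if w' = w then (if x = a then 1 else 0) else 1)]
  have h2 : ∀ w', ∑ x, p x * (if w' = w then (if x = a then 1 else 0) else 1) =
      if w' = w then p a else 1 := by
    intro w'
    by_cases h : w' = w <;> simp [h, hp]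
  simp only [h2, Finset.prod_ite_eq', Finset.mem_univ, if_true]
  ring

lemma cb_two {A : Type} [Fintype A] (p : A → ℝ) (hp : ∑ a, p a = 1) {m : ℕ} (w v : Fin m)
    (hwv : v ≠ w) (f : A → A → ℝ) :
    ∑ c : Fin m → A, (∏ w', p (c w')) * f (c w) (c v) = ∑ a, p a * ∑ b, p b * f a b := by
  classical
  have h1 : ∀ c : Fin m → A, (∏ w', p (c w')) * f (c w) (c v) =
      ∑ a, ∑ b, f a b * ∏ w', (p (c w') * ((if w' = w then (if c w' = a then 1 else 0) else 1) *
        (if w' = v then (if c w' = b then 1 else 0) else 1))) := by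
    intro c
    simp only [Finset.prod_mul_distrib, Finset.prod_ite_eq', Finset.mem_univ, if_true]
    simp [mul_comm]
  simp only [h1]
  rw [Finset.sum_comm]
  refine Finset.sum_congr rfl fun a _ => ?_
  rw [Finset.sum_comm, Finset.mul_sum]
  refine Finset.sum_congr rfl fun b _ => ?_
  rw [← Finset.mul_sum, sum_pi_prod (fun w' x => p x * ((if w' = w then (if x = a then 1 else 0) else 1) *
        (if w' = v then (if x = b then 1 else 0) else 1)))]
  have h2 : ∀ w', ∑ x, p x * ((if w' = w then (if x = a then 1 else 0) else 1) *
        (if w' = v then (if x = b then 1 else 0) else 1)) =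
      (if w' = w then p a else 1) * (if w' = v then p b else 1) := by
    intro w'
    by_cases h : w' = w
    · have : w' ≠ v := fun h' => hwv (h'.symm.trans h)
      simp [h, hwv.symm]
    · by_cases h' : w' = v <;> simp [h, h', hp, hwv]
  simp only [h2, Finset.prod_mul_distrib, Finset.prod_ite_eq', Finset.mem_univ, if_true]
  ring

lemma prod_pmf {A : Type} [Fintype A] {p : A → ℝ} (hp : isPMF p) (m : ℕ) :
    isPMF (fun c : Fin m → A => ∏ w, p (c w)) :=
  ⟨fun c => Finset.prod_nonneg fun w _ => hp.1 _, by
    rw [sum_pi_prod (fun _ a => p a)]; simp [hp.2]⟩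

lemma avg_exists {I : Type} [Fintype I] (w X : I → ℝ) (hw : isPMF w) (K : ℝ)
    (h : ∑ i, w i * X i ≤ K) : ∃ i, X i ≤ K := by
  by_contra hcon
  push Not at hcon
  have h1 : ∀ i ∈ (Finset.univ : Finset I), 0 ≤ w i * (X i - K) := fun i _ =>
    mul_nonneg (hw.1 i) (by linarith [hcon i])
  have h2 : ∑ i, w i * (X i - K) = ∑ i, w i * X i - K := by
    simp only [mul_sub, Finset.sum_sub_distrib, ← Finset.sum_mul, hw.2, one_mul]
  have h3 : ∑ i, w i * (X i - K) = 0 := le_antisymm (by linarith) (Finset.sum_nonneg h1)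
  have h4 := (Finset.sum_eq_zero_iff_of_nonneg h1).1 h3
  have h5 : ∑ i, w i = 0 := Finset.sum_eq_zero fun i hi =>
    (mul_eq_zero.1 (h4 i hi)).resolve_right (by linarith [hcon i])
  rw [hw.2] at h5
  exact one_ne_zero h5

/-- One-shot random coding bound for the MAC with successive threshold decoding. -/
lemma oneshot {A B Z : Type} [Fintype A] [Fintype B] [Fintype Z] (p : A → ℝ) (q : B → ℝ)
    (hp : isPMF p) (hq : isPMF q) (W : A → B → Z → ℝ) (hW : ∀ a b z, 0 ≤ W a b z)
    (hWs : ∀ a b, ∑ z, W a b z = 1)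
    (W1 : A → Z → ℝ) (Q : Z → ℝ) (hW1 : ∀ a z, W1 a z = ∑ b, q b * W a b z)
    (hQ : ∀ z, Q z = ∑ a, p a * W1 a z) (τ1 τ2 : ℝ) (h1 : 0 < τ1) (h2 : 0 < τ2)
    (Ma Mb : ℕ) (hMa : 0 < Ma) (hMb : 0 < Mb) :
    ∃ (cA : Fin Ma → A) (cB : Fin Mb → B) (dec : Z → Fin Ma × Fin Mb),
      (Ma : ℝ)⁻¹ * (Mb : ℝ)⁻¹ * ∑ wa, ∑ wb, ∑ z,
        (if dec z ≠ (wa, wb) then W (cA wa) (cB wb) z else 0) ≤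
      (∑ a, p a * ∑ b, q b * ∑ z, W a b z * (if W1 a z ≤ τ1 * Q z then 1 else 0)) +
      (∑ a, p a * ∑ b, q b * ∑ z, W a b z * (if W a b z ≤ τ2 * W1 a z then 1 else 0)) +
      (Ma - 1) * (1 / τ1) + (Mb - 1) * (1 / τ2) := by
  classical
  set f1 : A → Z → ℝ := fun a z => if W1 a z ≤ τ1 * Q z then 1 else 0 with hf1
  set f2 : A → B → Z → ℝ := fun a b z => if W a b z ≤ τ2 * W1 a z then 1 else 0 with hf2
  set g1 : A → Z → ℝ := fun a z => if W1 a z ≤ τ1 * Q z then 0 else 1 with hg1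
  set g2 : A → B → Z → ℝ := fun a b z => if W a b z ≤ τ2 * W1 a z then 0 else 1 with hg2
  have f1n : ∀ a z, 0 ≤ f1 a z := fun a z => by simp only [hf1]; split_ifs <;> norm_num
  have f2n : ∀ a b z, 0 ≤ f2 a b z := fun a b z => by simp only [hf2]; split_ifs <;> norm_num
  have g1n : ∀ a z, 0 ≤ g1 a z := fun a z => by simp only [hg1]; split_ifs <;> norm_num
  have g2n : ∀ a b z, 0 ≤ g2 a b z := fun a b z => by simp only [hg2]; split_ifs <;> norm_num
  set e1 := ∑ a, p a * ∑ b, q b * ∑ z, W a b z * f1 a z with he1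
  set e2 := ∑ a, p a * ∑ b, q b * ∑ z, W a b z * f2 a b z with he2
  have W1n : ∀ a z, 0 ≤ W1 a z := fun a z => by
    rw [hW1]; exact Finset.sum_nonneg fun b _ => mul_nonneg (hq.1 b) (hW _ _ _)
  have W1s : ∀ a, ∑ z, W1 a z = 1 := fun a => by
    simp only [hW1]
    rw [Finset.sum_comm]
    simp only [← Finset.mul_sum, hWs, mul_one, hq.2]
  -- the decoder
  have hdec : ∀ (cA : Fin Ma → A) (cB : Fin Mb → B), ∃ dec : Z → Fin Ma × Fin Mb, ∀ wa wb z,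
      (if dec z ≠ (wa, wb) then W (cA wa) (cB wb) z else 0) ≤
      W (cA wa) (cB wb) z * f1 (cA wa) z + W (cA wa) (cB wb) z * f2 (cA wa) (cB wb) z +
      (∑ wa', if wa' = wa then 0 else W (cA wa) (cB wb) z * g1 (cA wa') z) +
      (∑ wb', if wb' = wb then 0 else W (cA wa) (cB wb) z * g2 (cA wa) (cB wb') z) := by
    intro cA cB
    let G : Fin Ma × Fin Mb → Z → Prop := fun w z =>
      (∀ wa', (¬ W1 (cA wa') z ≤ τ1 * Q z) ↔ wa' = w.1) ∧
      (∀ wb', (¬ W (cA w.1) (cB wb') z ≤ τ2 * W1 (cA w.1) z) ↔ wb' = w.2)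
    have Guniq : ∀ w w' z, G w z → G w' z → w = w' := by
      intro w w' z hw hw'
      have e : w.1 = w'.1 := (hw'.1 w.1).1 ((hw.1 w.1).2 rfl)
      have e' : w.2 = w'.2 := (hw'.2 w.2).1 (by rw [← e]; exact (hw.2 w.2).2 rfl)
      exact Prod.ext e e'
    refine ⟨fun z => if h : ∃ w, G w z then h.choose else (⟨0, hMa⟩, ⟨0, hMb⟩), ?_⟩
    intro wa wb z
    beta_reduce
    have n1 : ∀ wa', 0 ≤ (if wa' = wa then 0 else W (cA wa) (cB wb) z * g1 (cA wa') z) := by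
      intro wa'; split_ifs
      · exact le_rfl
      · exact mul_nonneg (hW _ _ _) (g1n _ _)
    have n2 : ∀ wb', 0 ≤ (if wb' = wb then 0 else W (cA wa) (cB wb) z * g2 (cA wa) (cB wb') z) := by
      intro wb'; split_ifs
      · exact le_rfl
      · exact mul_nonneg (hW _ _ _) (g2n _ _ _)
    have m1 := mul_nonneg (hW (cA wa) (cB wb) z) (f1n (cA wa) z)
    have m2 := mul_nonneg (hW (cA wa) (cB wb) z) (f2n (cA wa) (cB wb) z)
    have m3 := Finset.sum_nonneg fun wa' (_ : wa' ∈ Finset.univ) => n1 wa'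
    have m4 := Finset.sum_nonneg fun wb' (_ : wb' ∈ Finset.univ) => n2 wb'
    by_cases hG : G (wa, wb) z
    · have hex : ∃ w, G w z := ⟨_, hG⟩
      have : hex.choose = (wa, wb) := Guniq _ _ z hex.choose_spec hG
      rw [dif_pos hex, this]
      simp only [ne_eq, not_true_eq_false, if_false]
      positivity
    · have hle : (if (if h : ∃ w, G w z then h.choose else (⟨0, hMa⟩, ⟨0, hMb⟩)) ≠ (wa, wb) then
          W (cA wa) (cB wb) z else 0) ≤ W (cA wa) (cB wb) z := by
        split_ifs <;> first | exact le_rfl | exact hW _ _ _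
      refine hle.trans ?_
      by_cases c1 : W1 (cA wa) z ≤ τ1 * Q z
      · have : f1 (cA wa) z = 1 := by simp only [hf1, c1, if_true]
        rw [this]; linarith
      by_cases c2 : W (cA wa) (cB wb) z ≤ τ2 * W1 (cA wa) z
      · have : f2 (cA wa) (cB wb) z = 1 := by simp only [hf2, c2, if_true]
        rw [this]; linarith
      by_cases c3 : ∃ wa', wa' ≠ wa ∧ ¬ W1 (cA wa') z ≤ τ1 * Q z
      · obtain ⟨wa', hne, hc⟩ := c3
        have := Finset.single_le_sum (fun wa' (_ : wa' ∈ Finset.univ) => n1 wa') (Finset.mem_univ wa')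
        have hg : g1 (cA wa') z = 1 := by simp only [hg1, hc, if_false]
        rw [if_neg hne, hg] at this
        linarith
      by_cases c4 : ∃ wb', wb' ≠ wb ∧ ¬ W (cA wa) (cB wb') z ≤ τ2 * W1 (cA wa) z
      · obtain ⟨wb', hne, hc⟩ := c4
        have := Finset.single_le_sum (fun wb' (_ : wb' ∈ Finset.univ) => n2 wb') (Finset.mem_univ wb')
        have hg : g2 (cA wa) (cB wb') z = 1 := by simp only [hg2, hc, if_false]
        rw [if_neg hne, hg] at this
        linarith
      exfalso
      apply hG
      refine ⟨fun wa' => ⟨fun h => ?_, fun h => ?_⟩, fun wb' => ⟨fun h => ?_, fun h => ?_⟩⟩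
      · by_contra hne; exact c3 ⟨wa', hne, h⟩
      · subst h; exact c1
      · by_contra hne; exact c4 ⟨wb', hne, h⟩
      · subst h; exact c2
  -- expectation over the codebooks
  set err : (Fin Ma → A) → (Fin Mb → B) → Fin Ma → Fin Mb → ℝ := fun cA cB wa wb =>
    ∑ z, (W (cA wa) (cB wb) z * f1 (cA wa) z + W (cA wa) (cB wb) z * f2 (cA wa) (cB wb) z +
      (∑ wa', if wa' = wa then 0 else W (cA wa) (cB wb) z * g1 (cA wa') z) +
      (∑ wb', if wb' = wb then 0 else W (cA wa) (cB wb) z * g2 (cA wa) (cB wb') z)) with herr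
  have T3 : ∑ a, p a * ∑ a', p a' * ∑ b, q b * ∑ z, W a b z * g1 a' z ≤ 1 / τ1 := by
    have r1 : ∀ a a', ∑ b, q b * ∑ z, W a b z * g1 a' z = ∑ z, W1 a z * g1 a' z := by
      intro a a'
      simp only [hW1, Finset.mul_sum, Finset.sum_mul]
      rw [Finset.sum_comm]
      refine Finset.sum_congr rfl fun z _ => Finset.sum_congr rfl fun b _ => by ring
    have r2 : ∑ a, p a * ∑ a', p a' * ∑ b, q b * ∑ z, W a b z * g1 a' z =
        ∑ a', p a' * ∑ z, Q z * g1 a' z := by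
      simp only [r1]
      simp only [hQ, Finset.mul_sum, Finset.sum_mul]
      rw [Finset.sum_comm]
      refine Finset.sum_congr rfl fun a' _ => ?_
      rw [Finset.sum_comm]
      refine Finset.sum_congr rfl fun z _ => Finset.sum_congr rfl fun a _ => by ring
    rw [r2]
    calc _ ≤ ∑ a', p a' * ∑ z, W1 a' z * (1 / τ1) := by
          refine Finset.sum_le_sum fun a' _ => mul_le_mul_of_nonneg_left ?_ (hp.1 a')
          refine Finset.sum_le_sum fun z _ => ?_
          simp only [hg1]
          split_ifs with h
          · have := W1n a' z; simp only [mul_zero]; positivity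
          · rw [mul_one, mul_one_div, le_div_iff₀ h1]; linarith
      _ = 1 / τ1 := by simp only [← Finset.sum_mul, W1s, one_mul, hp.2]
  have T4 : ∑ a, p a * ∑ b, q b * ∑ b', q b' * ∑ z, W a b z * g2 a b' z ≤ 1 / τ2 := by
    have r1 : ∀ a, ∑ b, q b * ∑ b', q b' * ∑ z, W a b z * g2 a b' z =
        ∑ b', q b' * ∑ z, W1 a z * g2 a b' z := by
      intro a
      simp only [hW1, Finset.mul_sum, Finset.sum_mul]
      rw [Finset.sum_comm]
      refine Finset.sum_congr rfl fun b' _ => ?_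
      rw [Finset.sum_comm]
      refine Finset.sum_congr rfl fun z _ => Finset.sum_congr rfl fun b _ => by ring
    simp only [r1]
    calc _ ≤ ∑ a, p a * ∑ b', q b' * ∑ z, W a b' z * (1 / τ2) := by
          refine Finset.sum_le_sum fun a _ => mul_le_mul_of_nonneg_left ?_ (hp.1 a)
          refine Finset.sum_le_sum fun b' _ => mul_le_mul_of_nonneg_left ?_ (hq.1 b')
          refine Finset.sum_le_sum fun z _ => ?_
          simp only [hg2]
          split_ifs with h
          · have := hW a b' z; simp only [mul_zero]; positivity
          · rw [mul_one, mul_one_div, le_div_iff₀ h2]; linarith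
      _ = 1 / τ2 := by simp only [← Finset.sum_mul, hWs, one_mul, hp.2, hq.2]
  have hE : ∀ wa wb, ∑ cA : Fin Ma → A, (∏ w, p (cA w)) * ∑ cB : Fin Mb → B, (∏ w, q (cB w)) *
      err cA cB wa wb ≤ e1 + e2 + (Ma - 1) * (1 / τ1) + (Mb - 1) * (1 / τ2) := by
    intro wa wb
    have s0 : ∀ cA cB, err cA cB wa wb =
        ∑ z, W (cA wa) (cB wb) z * f1 (cA wa) z + ∑ z, W (cA wa) (cB wb) z * f2 (cA wa) (cB wb) z +
        (∑ wa', if wa' = wa then 0 else ∑ z, W (cA wa) (cB wb) z * g1 (cA wa') z) +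
        (∑ wb', if wb' = wb then 0 else ∑ z, W (cA wa) (cB wb) z * g2 (cA wa) (cB wb') z) := by
      intro cA cB
      simp only [herr, Finset.sum_add_distrib]
      congr 1
      · congr 1
        rw [Finset.sum_comm]
        refine Finset.sum_congr rfl fun w _ => ?_
        split_ifs <;> simp
      · rw [Finset.sum_comm]
        refine Finset.sum_congr rfl fun w _ => ?_
        split_ifs <;> simp
    have s1 : ∀ cA : Fin Ma → A, ∑ cB : Fin Mb → B, (∏ w, q (cB w)) * err cA cB wa wb =
        ∑ b, q b * ∑ z, W (cA wa) b z * f1 (cA wa) z + ∑ b, q b * ∑ z, W (cA wa) b z * f2 (cA wa) b z +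
        (∑ wa', if wa' = wa then 0 else ∑ b, q b * ∑ z, W (cA wa) b z * g1 (cA wa') z) +
        (∑ wb' : Fin Mb, if wb' = wb then 0 else
          ∑ b, q b * ∑ b', q b' * ∑ z, W (cA wa) b z * g2 (cA wa) b' z) := by
      intro cA
      simp only [s0, mul_add, Finset.sum_add_distrib]
      congr 1
      · congr 1
        · congr 1
          · exact cb_one q hq.2 wb (fun b => ∑ z, W (cA wa) b z * f1 (cA wa) z)
          · exact cb_one q hq.2 wb (fun b => ∑ z, W (cA wa) b z * f2 (cA wa) b z)
        · simp only [Finset.mul_sum (s := (Finset.univ : Finset (Fin Ma)))]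
          rw [Finset.sum_comm]
          refine Finset.sum_congr rfl fun w _ => ?_
          split_ifs
          · simp
          · exact cb_one q hq.2 wb (fun b => ∑ z, W (cA wa) b z * g1 (cA w) z)
      · simp only [Finset.mul_sum (s := (Finset.univ : Finset (Fin Mb)))]
        rw [Finset.sum_comm]
        refine Finset.sum_congr rfl fun w _ => ?_
        split_ifs with h
        · simp
        · exact cb_two q hq.2 wb w h (fun b b' => ∑ z, W (cA wa) b z * g2 (cA wa) b' z)
    have s2 : ∑ cA : Fin Ma → A, (∏ w, p (cA w)) * ∑ cB : Fin Mb → B, (∏ w, q (cB w)) *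
        err cA cB wa wb = e1 + e2 +
        (∑ wa' : Fin Ma, if wa' = wa then 0 else
          ∑ a, p a * ∑ a', p a' * ∑ b, q b * ∑ z, W a b z * g1 a' z) +
        (∑ wb' : Fin Mb, if wb' = wb then 0 else
          ∑ a, p a * ∑ b, q b * ∑ b', q b' * ∑ z, W a b z * g2 a b' z) := by
      simp only [s1, mul_add, Finset.sum_add_distrib]
      congr 1
      · congr 1
        · congr 1
          · exact cb_one p hp.2 wa (fun a => ∑ b, q b * ∑ z, W a b z * f1 a z)
          · exact cb_one p hp.2 wa (fun a => ∑ b, q b * ∑ z, W a b z * f2 a b z)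
        · simp only [Finset.mul_sum (s := (Finset.univ : Finset (Fin Ma)))]
          rw [Finset.sum_comm]
          refine Finset.sum_congr rfl fun w _ => ?_
          split_ifs with h
          · simp
          · exact cb_two p hp.2 wa w h (fun a a' => ∑ b, q b * ∑ z, W a b z * g1 a' z)
      · simp only [Finset.mul_sum (s := (Finset.univ : Finset (Fin Mb)))]
        rw [Finset.sum_comm]
        refine Finset.sum_congr rfl fun w _ => ?_
        split_ifs with h
        · simp
        · exact cb_one p hp.2 wa (fun a => ∑ b, q b * ∑ b', q b' * ∑ z, W a b z * g2 a b' z)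
    have cnt : ∀ (m : ℕ) (w : Fin m) (x : ℝ), ∑ w' : Fin m, (if w' = w then 0 else x) = (m - 1) * x := by
      intro m w x
      have : ∀ w' : Fin m, (if w' = w then 0 else x) = x - if w' = w then x else 0 := by
        intro w'; split_ifs <;> simp
      simp only [this, Finset.sum_sub_distrib, Finset.sum_ite_eq', Finset.mem_univ, if_true]
      simp; ring
    rw [s2, cnt, cnt]
    have ga : (0:ℝ) ≤ Ma - 1 := by
      have : (1:ℝ) ≤ Ma := by exact_mod_cast hMa
      linarith
    have gb : (0:ℝ) ≤ Mb - 1 := by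
      have : (1:ℝ) ≤ Mb := by exact_mod_cast hMb
      linarith
    have u3 := mul_le_mul_of_nonneg_left T3 ga
    have u4 := mul_le_mul_of_nonneg_left T4 gb
    linarith
  have hMa' : (0 : ℝ) < Ma := by exact_mod_cast hMa
  have hMb' : (0 : ℝ) < Mb := by exact_mod_cast hMb
  set K := e1 + e2 + (Ma - 1) * (1 / τ1) + (Mb - 1) * (1 / τ2) with hK
  obtain ⟨⟨cA, cB⟩, hc⟩ := avg_exists
    (fun i : (Fin Ma → A) × (Fin Mb → B) => (∏ w, p (i.1 w)) * ∏ w, q (i.2 w))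
    (fun i => ∑ wa, ∑ wb, err i.1 i.2 wa wb)
    ⟨fun i => mul_nonneg ((prod_pmf hp Ma).1 i.1) ((prod_pmf hq Mb).1 i.2), by
      rw [Fintype.sum_prod_type]
      simp only [← Finset.mul_sum]
      rw [(prod_pmf hq Mb).2]
      simp only [mul_one]
      exact (prod_pmf hp Ma).2⟩ (Ma * Mb * K) (by
      have : ∑ i : (Fin Ma → A) × (Fin Mb → B), ((∏ w, p (i.1 w)) * ∏ w, q (i.2 w)) *
          ∑ wa, ∑ wb, err i.1 i.2 wa wb = ∑ wa, ∑ wb, ∑ cA : Fin Ma → A, (∏ w, p (cA w)) *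
          ∑ cB : Fin Mb → B, (∏ w, q (cB w)) * err cA cB wa wb := by
        simp only [Finset.mul_sum]
        rw [Finset.sum_comm]
        refine Finset.sum_congr rfl fun wa _ => ?_
        rw [Finset.sum_comm]
        refine Finset.sum_congr rfl fun wb _ => ?_
        rw [Fintype.sum_prod_type]
        refine Finset.sum_congr rfl fun cA _ => Finset.sum_congr rfl fun cB _ => by ring
      rw [this]
      refine (Finset.sum_le_sum fun wa _ => Finset.sum_le_sum fun wb _ => hE wa wb).trans ?_
      simp [mul_assoc])
  obtain ⟨dec, hd⟩ := hdec cA cB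
  refine ⟨cA, cB, dec, ?_⟩
  have hfin : ∑ wa, ∑ wb, ∑ z, (if dec z ≠ (wa, wb) then W (cA wa) (cB wb) z else 0) ≤ Ma * Mb * K :=
    (Finset.sum_le_sum fun wa _ => Finset.sum_le_sum fun wb _ =>
      Finset.sum_le_sum fun z _ => hd wa wb z).trans hc
  calc _ ≤ (Ma : ℝ)⁻¹ * (Mb : ℝ)⁻¹ * (Ma * Mb * K) :=
        mul_le_mul_of_nonneg_left hfin (by positivity)
    _ = K := by field_simp


/-! ### I.i.d. random coding -/

lemma typ_prob {Ω : Type} [Fintype Ω] (P : Ω → ℝ) (hP : isPMF P) (f g : Ω → ℝ)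
    (hf : ∀ ω, P ω ≠ 0 → 0 < f ω) (hg : ∀ ω, P ω ≠ 0 → 0 < g ω) (c : ℝ)
    (hc : c < ∑ x, P x * Real.log (f x / g x)) (ε : ℝ) (hε : 0 < ε) :
    ∃ N : ℕ, ∀ n : ℕ, N ≤ n →
      ∑ ω : Fin n → Ω, (∏ t, P (ω t)) *
        (if ∏ t, f (ω t) ≤ Real.exp (n * c) * ∏ t, g (ω t) then 1 else 0) ≤ ε := by
  obtain ⟨N, hN⟩ := wlln P hP (fun x => Real.log (f x / g x)) c hc ε hε
  refine ⟨N, fun n hn => le_trans (Finset.sum_le_sum fun ω _ => ?_) (hN n hn)⟩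
  by_cases h0 : ∏ t, P (ω t) = 0
  · rw [h0, zero_mul, zero_mul]
  have hne : ∀ t, P (ω t) ≠ 0 := fun t ht => h0 (Finset.prod_eq_zero (Finset.mem_univ t) ht)
  refine mul_le_mul_of_nonneg_left ?_ (Finset.prod_nonneg fun t _ => hP.1 _)
  by_cases h1 : ∏ t, f (ω t) ≤ Real.exp (n * c) * ∏ t, g (ω t)
  · have hgp : 0 < ∏ t, g (ω t) := Finset.prod_pos fun t _ => hg _ (hne t)
    have hfp : 0 < ∏ t, f (ω t) := Finset.prod_pos fun t _ => hf _ (hne t)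
    have h2 : ∑ t, Real.log (f (ω t) / g (ω t)) ≤ n * c := by
      have e : ∑ t, Real.log (f (ω t) / g (ω t)) = Real.log ((∏ t, f (ω t)) / ∏ t, g (ω t)) := by
        rw [← Finset.prod_div_distrib, Real.log_prod]
        intro t _
        exact (div_pos (hf _ (hne t)) (hg _ (hne t))).ne'
      rw [e, Real.log_le_iff_le_exp (div_pos hfp hgp), div_le_iff₀ hgp]
      exact h1
    rw [if_pos h1, if_pos h2]
  · rw [if_neg h1]; split_ifs <;> norm_num

lemma sum_pi_pair {α β : Type} [Fintype α] [Fintype β] {n : ℕ}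
    (F : (Fin n → α) → (Fin n → β) → ℝ) :
    ∑ ω : Fin n → α × β, F (fun t => (ω t).1) (fun t => (ω t).2) = ∑ g, ∑ h, F g h := by
  rw [← Fintype.sum_prod_type' (f := F)]
  exact Fintype.sum_equiv (Equiv.arrowProdEquivProdArrow (Fin n) (fun _ => α) (fun _ => β)) _ _
    (fun ω => rfl)

lemma iid_mac {A B Z : Type} [Fintype A] [Fintype B] [Fintype Z] (p : A → ℝ) (q : B → ℝ)
    (hp : isPMF p) (hq : isPMF q) (k : A → B → Z → ℝ) (hk : ∀ a b z, 0 ≤ k a b z)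
    (hks : ∀ a b, ∑ z, k a b z = 1) (w1 : A → Z → ℝ) (r : Z → ℝ)
    (hw1 : ∀ a z, w1 a z = ∑ b, q b * k a b z) (hr : ∀ z, r z = ∑ a, p a * w1 a z)
    (c1 c2 : ℝ)
    (hc1 : c1 < ∑ x : A × B × Z, p x.1 * q x.2.1 * k x.1 x.2.1 x.2.2 *
      Real.log (w1 x.1 x.2.2 / r x.2.2))
    (hc2 : c2 < ∑ x : A × B × Z, p x.1 * q x.2.1 * k x.1 x.2.1 x.2.2 *
      Real.log (k x.1 x.2.1 x.2.2 / w1 x.1 x.2.2))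
    (ε : ℝ) (hε : 0 < ε) :
    ∃ N : ℕ, ∀ n : ℕ, N ≤ n → ∀ Ma Mb : ℕ, 0 < Ma → 0 < Mb →
      ∃ (cA : Fin Ma → Fin n → A) (cB : Fin Mb → Fin n → B)
        (dec : (Fin n → Z) → Fin Ma × Fin Mb),
        (Ma : ℝ)⁻¹ * (Mb : ℝ)⁻¹ * ∑ wa, ∑ wb, ∑ z,
          (if dec z ≠ (wa, wb) then ∏ t, k (cA wa t) (cB wb t) (z t) else 0) ≤
        ε + ε + (Ma - 1) * (1 / Real.exp (n * c1)) + (Mb - 1) * (1 / Real.exp (n * c2)) := by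
  have w1n : ∀ a z, 0 ≤ w1 a z := fun a z => by
    rw [hw1]; exact Finset.sum_nonneg fun b _ => mul_nonneg (hq.1 b) (hk _ _ _)
  have hP : isPMF (fun x : A × B × Z => p x.1 * q x.2.1 * k x.1 x.2.1 x.2.2) := by
    refine ⟨fun x => mul_nonneg (mul_nonneg (hp.1 _) (hq.1 _)) (hk _ _ _), ?_⟩
    simp only [Fintype.sum_prod_type, ← Finset.mul_sum, hks, mul_one, hq.2, hp.2]
  have hP0 : ∀ x : A × B × Z, p x.1 * q x.2.1 * k x.1 x.2.1 x.2.2 ≠ 0 →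
      0 < p x.1 ∧ 0 < q x.2.1 ∧ 0 < k x.1 x.2.1 x.2.2 := by
    intro x hx
    refine ⟨lt_of_le_of_ne (hp.1 _) ?_, lt_of_le_of_ne (hq.1 _) ?_, lt_of_le_of_ne (hk _ _ _) ?_⟩
    all_goals intro h; apply hx; rw [← h]; ring
  have w1p : ∀ x : A × B × Z, p x.1 * q x.2.1 * k x.1 x.2.1 x.2.2 ≠ 0 → 0 < w1 x.1 x.2.2 := by
    intro x hx
    obtain ⟨h1, h2, h3⟩ := hP0 x hx
    rw [hw1]
    exact Finset.sum_pos' (fun b _ => mul_nonneg (hq.1 b) (hk _ _ _))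
      ⟨x.2.1, Finset.mem_univ _, mul_pos h2 h3⟩
  have rp : ∀ x : A × B × Z, p x.1 * q x.2.1 * k x.1 x.2.1 x.2.2 ≠ 0 → 0 < r x.2.2 := by
    intro x hx
    rw [hr]
    exact Finset.sum_pos' (fun a _ => mul_nonneg (hp.1 a) (w1n _ _))
      ⟨x.1, Finset.mem_univ _, mul_pos (hP0 x hx).1 (w1p x hx)⟩
  obtain ⟨N1, hN1⟩ := typ_prob _ hP (fun x => w1 x.1 x.2.2) (fun x => r x.2.2) w1p rp c1 hc1 ε hε
  obtain ⟨N2, hN2⟩ := typ_prob _ hP (fun x => k x.1 x.2.1 x.2.2) (fun x => w1 x.1 x.2.2)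
    (fun x hx => (hP0 x hx).2.2) w1p c2 hc2 ε hε
  refine ⟨max N1 N2, fun n hn Ma Mb hMa hMb => ?_⟩
  have conv : ∀ I : (Fin n → A) → (Fin n → B) → (Fin n → Z) → ℝ,
      ∑ ω : Fin n → A × B × Z, (∏ t, p (ω t).1 * q (ω t).2.1 * k (ω t).1 (ω t).2.1 (ω t).2.2) *
        I (fun t => (ω t).1) (fun t => (ω t).2.1) (fun t => (ω t).2.2) =
      ∑ a : Fin n → A, (∏ t, p (a t)) * ∑ b : Fin n → B, (∏ t, q (b t)) *
        ∑ z : Fin n → Z, (∏ t, k (a t) (b t) (z t)) * I a b z := by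
    intro I
    rw [sum_pi_pair (fun (a : Fin n → A) (bz : Fin n → B × Z) =>
      (∏ t, p (a t) * q (bz t).1 * k (a t) (bz t).1 (bz t).2) *
        I a (fun t => (bz t).1) (fun t => (bz t).2))]
    refine Finset.sum_congr rfl fun a _ => ?_
    rw [sum_pi_pair (fun (b : Fin n → B) (z : Fin n → Z) =>
      (∏ t, p (a t) * q (b t) * k (a t) (b t) (z t)) * I a b z)]
    simp only [Finset.mul_sum, Finset.prod_mul_distrib]
    refine Finset.sum_congr rfl fun b _ => Finset.sum_congr rfl fun z _ => by ring
  obtain ⟨cA, cB, dec, h⟩ := oneshot (fun a : Fin n → A => ∏ t, p (a t))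
    (fun b : Fin n → B => ∏ t, q (b t)) (prod_pmf hp n) (prod_pmf hq n)
    (fun a b (z : Fin n → Z) => ∏ t, k (a t) (b t) (z t))
    (fun a b z => Finset.prod_nonneg fun t _ => hk _ _ _)
    (fun a b => by
      rw [sum_pi_prod (fun t z => k (a t) (b t) z)]; simp [hks])
    (fun a z => ∏ t, w1 (a t) (z t)) (fun z => ∏ t, r (z t))
    (fun a z => by
      simp only [← Finset.prod_mul_distrib]
      rw [sum_pi_prod (fun t b => q b * k (a t) b (z t))]
      simp only [hw1])
    (fun z => by
      simp only [← Finset.prod_mul_distrib]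
      rw [sum_pi_prod (fun t a => p a * w1 a (z t))]
      simp only [hr])
    (Real.exp (n * c1)) (Real.exp (n * c2)) (Real.exp_pos _) (Real.exp_pos _) Ma Mb hMa hMb
  refine ⟨cA, cB, dec, h.trans ?_⟩
  have e1 := hN1 n (le_trans (le_max_left _ _) hn)
  have e2 := hN2 n (le_trans (le_max_right _ _) hn)
  have e1' := (conv (fun a b z => if ∏ t, w1 (a t) (z t) ≤
    Real.exp (n * c1) * ∏ t, r (z t) then 1 else 0)).symm.trans_le e1
  have e2' := (conv (fun a b z => if ∏ t, k (a t) (b t) (z t) ≤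
    Real.exp (n * c2) * ∏ t, w1 (a t) (z t) then 1 else 0)).symm.trans_le e2
  linarith

/-- Law of states and outputs for a code built from strategy codewords. -/
lemma pw_strat {Wa Wb : Type} (M : FSMAC S Sa Sb Xa Xb Y) {n : ℕ} (cA : Wa → Fin n → Sa → Xa)
    (cB : Wb → Fin n → Sb → Xb)
    (eA : (t : ℕ) → (Fin (t + 1) → Sa) → Wa → Xa)
    (eB : (t : ℕ) → (Fin (t + 1) → Sb) → Wb → Xb)
    (hA : ∀ (t : Fin n) h w, eA t h w = cA w t (h (Fin.last t)))
    (hB : ∀ (t : Fin n) h w, eB t h w = cB w t (h (Fin.last t)))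
    (wa : Wa) (wb : Wb) (s : Fin n → S) (y : Fin n → Y) :
    pw M eA eB n wa wb s y = ∏ t, kk M (cA wa t) (cB wb t) (s t) (y t) := by
  have h1 : ∀ sa sb, jp M eA eB n wa wb s sa sb y = ∏ t, (M.PS (s t) * M.Qa (s t) (sa t) *
      M.Qb (s t) (sb t) * M.chan (cA wa t (sa t)) (cB wb t (sb t)) (s t) (y t)) := by
    intro sa sb
    unfold jp
    refine Finset.prod_congr rfl fun t _ => ?_
    rw [hA, hB]
    rfl
  unfold pw
  simp only [h1]
  have h2 : ∀ sa : Fin n → Sa, ∑ sb : Fin n → Sb, ∏ t, (M.PS (s t) * M.Qa (s t) (sa t) *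
      M.Qb (s t) (sb t) * M.chan (cA wa t (sa t)) (cB wb t (sb t)) (s t) (y t)) =
      ∏ t, ∑ sb, (M.PS (s t) * M.Qa (s t) (sa t) *
      M.Qb (s t) sb * M.chan (cA wa t (sa t)) (cB wb t sb) (s t) (y t)) := fun sa =>
    sum_pi_prod (fun t sb => M.PS (s t) * M.Qa (s t) (sa t) *
      M.Qb (s t) sb * M.chan (cA wa t (sa t)) (cB wb t sb) (s t) (y t))
  simp only [h2]
  rw [sum_pi_prod (fun t sa => ∑ sb, (M.PS (s t) * M.Qa (s t) sa *
      M.Qb (s t) sb * M.chan (cA wa t sa) (cB wb t sb) (s t) (y t)))]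
  refine Finset.prod_congr rfl fun t _ => ?_
  simp only [kk, stratKernel, Finset.mul_sum]
  refine Finset.sum_congr rfl fun a _ => Finset.sum_congr rfl fun b _ => by ring

/-- Codes from strategy codewords. -/
lemma code_strat (M : FSMAC S Sa Sb Xa Xb Y) [Nonempty Xa] [Nonempty Xb] {n Ma Mb : ℕ}
    (cA : Fin Ma → Fin n → Sa → Xa) (cB : Fin Mb → Fin n → Sb → Xb)
    (dec : (Fin n → S × Y) → Fin Ma × Fin Mb) :
    ∃ C : Code M n (Fin Ma) (Fin Mb), errProb M C = (Ma : ℝ)⁻¹ * (Mb : ℝ)⁻¹ * ∑ wa, ∑ wb, ∑ z,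
      (if dec z ≠ (wa, wb) then ∏ t, kk M (cA wa t) (cB wb t) (z t).1 (z t).2 else 0) := by
  classical
  let C : Code M n (Fin Ma) (Fin Mb) :=
    ⟨fun t h w => cA w t (h (Fin.last t)), fun t h w => cB w t (h (Fin.last t)),
      fun s y => dec (fun t => (s t, y t))⟩
  let eA : (t : ℕ) → (Fin (t + 1) → Sa) → Fin Ma → Xa := fun t h w =>
    if ht : t < n then cA w ⟨t, ht⟩ (h (Fin.last t)) else Classical.arbitrary Xa
  let eB : (t : ℕ) → (Fin (t + 1) → Sb) → Fin Mb → Xb := fun t h w =>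
    if ht : t < n then cB w ⟨t, ht⟩ (h (Fin.last t)) else Classical.arbitrary Xb
  have hA : ∀ (t : Fin n) h w, eA t h w = cA w t (h (Fin.last t)) := fun t h w => by
    simp [eA, t.isLt]
  have hB : ∀ (t : Fin n) h w, eB t h w = cB w t (h (Fin.last t)) := fun t h w => by
    simp [eB, t.isLt]
  refine ⟨C, ?_⟩
  rw [errProb_eq M C eA eB (fun t => by funext h w; exact hA t h w)
    (fun t => by funext h w; exact hB t h w)]
  congr 1
  refine Finset.sum_congr rfl fun wa _ => Finset.sum_congr rfl fun wb _ => ?_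
  simp only [pw_strat M cA cB eA eB hA hB]
  rw [← sum_pi_pair (fun (s : Fin n → S) (y : Fin n → Y) => if C.dec s y ≠ (wa, wb) then
    ∏ t, kk M (cA wa t) (cB wb t) (s t) (y t) else 0)]

lemma ceil_facts (x : ℝ) (n : ℕ) (hn : 0 < n) (c : ℝ) :
    0 < ⌈Real.exp (n * x)⌉₊ ∧
    max 0 (x / Real.log 2) ≤ Real.logb 2 (⌈Real.exp (n * x)⌉₊ : ℕ) / n ∧
    ((⌈Real.exp (n * x)⌉₊ : ℕ) - 1 : ℝ) * (1 / Real.exp (n * (x + c))) ≤ Real.exp (-(n * c)) := by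
  have hpos : 0 < ⌈Real.exp (n * x)⌉₊ := Nat.ceil_pos.2 (Real.exp_pos _)
  have hn' : (0 : ℝ) < n := by exact_mod_cast hn
  have hl2 : 0 < Real.log 2 := Real.log_pos (by norm_num)
  refine ⟨hpos, max_le ?_ ?_, ?_⟩
  · refine div_nonneg (Real.logb_nonneg (by norm_num) ?_) hn'.le
    exact_mod_cast hpos
  · rw [Real.logb, div_right_comm]
    refine div_le_div_of_nonneg_right ?_ hl2.le
    rw [le_div_iff₀ hn']
    have : Real.exp (n * x) ≤ (⌈Real.exp (n * x)⌉₊ : ℝ) := Nat.le_ceil _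
    have h2 := Real.log_le_log (Real.exp_pos _) this
    rw [Real.log_exp] at h2
    linarith
  · have h1 : ((⌈Real.exp (n * x)⌉₊ : ℕ) - 1 : ℝ) ≤ Real.exp (n * x) := by
      linarith [Nat.ceil_lt_add_one (Real.exp_pos (n * x)).le]
    calc _ ≤ Real.exp (n * x) * (1 / Real.exp (n * (x + c))) :=
          mul_le_mul_of_nonneg_right h1 (by positivity)
      _ = Real.exp (-(n * c)) := by
          rw [one_div, ← Real.exp_neg, ← Real.exp_add]; congr 1; ring

lemma achiev (M : FSMAC S Sa Sb Xa Xb Y) [Nonempty Xa] [Nonempty Xb]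
    {πa : (Sa → Xa) → ℝ} {πb : (Sb → Xb) → ℝ} (ha : isPMF πa) (hb : isPMF πb)
    (η : ℝ) (hη : 0 < η) :
    ∃ Ra Rb, Achievable M Ra Rb ∧ Isum M πa πb - η ≤ Ra + Rb := by
  have hl2 : 0 < Real.log 2 := Real.log_pos (by norm_num)
  set k : (Sa → Xa) → (Sb → Xb) → S × Y → ℝ := fun ta tb z => kk M ta tb z.1 z.2 with hk
  set w1 : (Sa → Xa) → S × Y → ℝ := fun ta z => ∑ tb, πb tb * k ta tb z with hw1
  set r : S × Y → ℝ := fun z => ∑ ta, πa ta * w1 ta z with hr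
  have hkn : ∀ a b z, 0 ≤ k a b z := fun a b z => kk_nonneg M a b z.1 z.2
  have hks : ∀ a b, ∑ z, k a b z = 1 := fun a b => by
    rw [Fintype.sum_prod_type]; exact kk_sum M a b
  have hrr : ∀ z, r z = rr M πa πb z.1 z.2 := fun z => by
    simp only [hr, hw1, hk, rr, Finset.mul_sum]
    refine Finset.sum_congr rfl fun a _ => Finset.sum_congr rfl fun b _ => by ring
  set J1 := ∑ x : (Sa → Xa) × (Sb → Xb) × (S × Y), πa x.1 * πb x.2.1 * k x.1 x.2.1 x.2.2 *
      Real.log (w1 x.1 x.2.2 / r x.2.2) with hJ1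
  set J2 := ∑ x : (Sa → Xa) × (Sb → Xb) × (S × Y), πa x.1 * πb x.2.1 * k x.1 x.2.1 x.2.2 *
      Real.log (k x.1 x.2.1 x.2.2 / w1 x.1 x.2.2) with hJ2
  have w1n : ∀ a z, 0 ≤ w1 a z := fun a z =>
    Finset.sum_nonneg fun b _ => mul_nonneg (hb.1 b) (hkn _ _ _)
  have hJ : J1 + J2 = Isum M πa πb * Real.log 2 := by
    rw [Isum_eq M ha hb, hJ1, hJ2, ← Finset.sum_add_distrib]
    simp only [Fintype.sum_prod_type]
    refine Finset.sum_congr rfl fun a _ => Finset.sum_congr rfl fun b _ =>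
      Finset.sum_congr rfl fun s _ => Finset.sum_congr rfl fun y _ => ?_
    rw [← mul_add]
    by_cases h0 : πa a * πb b * k a b (s, y) = 0
    · rw [h0, zero_mul, zero_mul]
    have p1 : πa a ≠ 0 := fun h => h0 (by rw [h]; ring)
    have p2 : πb b ≠ 0 := fun h => h0 (by rw [h]; ring)
    have p3 : k a b (s, y) ≠ 0 := fun h => h0 (by rw [h]; ring)
    have q2 : 0 < πb b := lt_of_le_of_ne (hb.1 b) p2.symm
    have q1 : 0 < πa a := lt_of_le_of_ne (ha.1 a) p1.symm
    have q3 : 0 < k a b (s, y) := lt_of_le_of_ne (hkn _ _ _) p3.symm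
    have w1p : 0 < w1 a (s, y) := Finset.sum_pos' (fun b _ => mul_nonneg (hb.1 b) (hkn _ _ _))
      ⟨b, Finset.mem_univ _, mul_pos q2 q3⟩
    have rp : 0 < r (s, y) := Finset.sum_pos' (fun a _ => mul_nonneg (ha.1 a) (w1n _ _))
      ⟨a, Finset.mem_univ _, mul_pos q1 w1p⟩
    have e : rr M πa πb s y = r (s, y) := (hrr (s, y)).symm
    rw [e, Real.log_div w1p.ne' rp.ne', Real.log_div q3.ne' w1p.ne']
    have e2 : kk M a b s y = k a b (s, y) := rfl
    rw [e2, Real.log_div q3.ne' rp.ne']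
    ring
  set δ := η * Real.log 2 / 4 with hδ
  have hδ0 : 0 < δ := by positivity
  refine ⟨max 0 ((J1 - 2 * δ) / Real.log 2), max 0 ((J2 - 2 * δ) / Real.log 2),
    ⟨le_max_left _ _, le_max_left _ _, fun ε hε => ?_⟩, ?_⟩
  · obtain ⟨N, hN⟩ := iid_mac πa πb ha hb k hkn hks w1 r (fun _ _ => rfl) (fun _ => rfl)
      (J1 - 2 * δ + δ) (J2 - 2 * δ + δ) (by linarith) (by linarith) (ε / 4) (by linarith)
    have ht : Filter.Tendsto (fun n : ℕ => Real.exp (-((n : ℝ) * δ))) Filter.atTop (nhds 0) :=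
      Real.tendsto_exp_neg_atTop_nhds_zero.comp
        (tendsto_natCast_atTop_atTop.atTop_mul_const hδ0)
    obtain ⟨N', hN'⟩ := Filter.eventually_atTop.1
      (ht.eventually (ge_mem_nhds (show (0:ℝ) < ε / 4 by linarith)))
    refine ⟨max (max N N') 1, fun n hn => ?_⟩
    have n1 : N ≤ n := le_trans (le_trans (le_max_left _ _) (le_max_left _ _)) hn
    have n2 : N' ≤ n := le_trans (le_trans (le_max_right _ _) (le_max_left _ _)) hn
    have n3 : 0 < n := le_trans (le_max_right _ _) hn
    obtain ⟨a1, a2, a3⟩ := ceil_facts (J1 - 2 * δ) n n3 δ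
    obtain ⟨b1, b2, b3⟩ := ceil_facts (J2 - 2 * δ) n n3 δ
    obtain ⟨cA, cB, dec, hd⟩ := hN n n1 _ _ a1 b1
    obtain ⟨C, hC⟩ := code_strat M cA cB dec
    refine ⟨_, _, C, a2, b2, ?_⟩
    rw [hC]
    have := hN' n n2
    refine hd.trans ?_
    linarith
  · have l1 := le_max_right 0 ((J1 - 2 * δ) / Real.log 2)
    have l2 := le_max_right 0 ((J2 - 2 * δ) / Real.log 2)
    have : (J1 - 2 * δ) / Real.log 2 + (J2 - 2 * δ) / Real.log 2 = Isum M πa πb - η := by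
      rw [← add_div, div_eq_iff hl2.ne', hδ]
      linarith
    linarith

lemma exists_pmf (α : Type) [Fintype α] [Nonempty α] : ∃ p : α → ℝ, isPMF p := by
  refine ⟨fun _ => (Fintype.card α : ℝ)⁻¹, fun _ => by positivity, ?_⟩
  simp

/-! ### Degenerate alphabets -/

lemma ach_empty_a (M : FSMAC S Sa Sb Xa Xb Y) [IsEmpty Xa] {Ra Rb : ℝ}
    (h : Achievable M Ra Rb) : Ra = 0 ∧ IsEmpty Y := by
  have := obsA_nonempty M
  have := state_nonempty M
  obtain ⟨h1, h2, h3⟩ := h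
  obtain ⟨N, hN⟩ := h3 1 one_pos
  obtain ⟨Ma, Mb, C, hA, hB, -⟩ := hN (max N 1) (le_max_left _ _)
  have hp : 0 < max N 1 := lt_of_lt_of_le one_pos (le_max_right _ _)
  have hMa : Ma = 0 := by
    by_contra hne
    exact IsEmpty.false (C.encA ⟨0, hp⟩ (fun _ => Classical.arbitrary Sa) ⟨0, Nat.pos_of_ne_zero hne⟩)
  subst hMa
  refine ⟨le_antisymm (by simpa using hA) h1, ⟨fun y => ?_⟩⟩
  exact (C.dec (fun _ => Classical.arbitrary S) (fun _ => y)).1.elim0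

lemma ach_empty_b (M : FSMAC S Sa Sb Xa Xb Y) [IsEmpty Xb] {Ra Rb : ℝ}
    (h : Achievable M Ra Rb) : Rb = 0 ∧ IsEmpty Y := by
  have := obsB_nonempty M
  have := state_nonempty M
  obtain ⟨h1, h2, h3⟩ := h
  obtain ⟨N, hN⟩ := h3 1 one_pos
  obtain ⟨Ma, Mb, C, hA, hB, -⟩ := hN (max N 1) (le_max_left _ _)
  have hp : 0 < max N 1 := lt_of_lt_of_le one_pos (le_max_right _ _)
  have hMb : Mb = 0 := by
    by_contra hne
    exact IsEmpty.false (C.encB ⟨0, hp⟩ (fun _ => Classical.arbitrary Sb) ⟨0, Nat.pos_of_ne_zero hne⟩)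
  subst hMb
  refine ⟨le_antisymm (by simpa using hB) h2, ⟨fun y => ?_⟩⟩
  exact (C.dec (fun _ => Classical.arbitrary S) (fun _ => y)).2.elim0

lemma logb_pow_rate (R : ℝ) (n : ℕ) (hn : 0 < n) :
    R ≤ Real.logb 2 (⌈Real.exp (n * (R * Real.log 2))⌉₊ : ℕ) / n := by
  have := (ceil_facts (R * Real.log 2) n hn 0).2.1
  rw [mul_div_cancel_right₀ _ (Real.log_pos (by norm_num : (1:ℝ) < 2)).ne'] at this
  exact (le_max_right _ _).trans this

lemma ach_deg_a (M : FSMAC S Sa Sb Xa Xb Y) [IsEmpty Xa] [IsEmpty Y] [Nonempty Xb] (R : ℝ)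
    (hR : 0 ≤ R) : Achievable M 0 R := by
  refine ⟨le_rfl, hR, fun ε hε => ⟨1, fun n hn => ?_⟩⟩
  have : Nonempty (Fin n) := ⟨⟨0, hn⟩⟩
  refine ⟨0, _, ⟨fun t h w => w.elim0, fun t h w => Classical.arbitrary Xb,
    fun s y => isEmptyElim (y (Classical.arbitrary (Fin n)))⟩, by simp, logb_pow_rate R n hn, ?_⟩
  simp [errProb, codePr, hε.le]

lemma ach_deg_b (M : FSMAC S Sa Sb Xa Xb Y) [IsEmpty Xb] [IsEmpty Y] [Nonempty Xa] (R : ℝ)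
    (hR : 0 ≤ R) : Achievable M R 0 := by
  refine ⟨hR, le_rfl, fun ε hε => ⟨1, fun n hn => ?_⟩⟩
  have : Nonempty (Fin n) := ⟨⟨0, hn⟩⟩
  refine ⟨_, 0, ⟨fun t h w => Classical.arbitrary Xa, fun t h w => w.elim0,
    fun s y => isEmptyElim (y (Classical.arbitrary (Fin n)))⟩, logb_pow_rate R n hn, by simp, ?_⟩
  simp [errProb, codePr, hε.le]

lemma sSup_zero_of_all (T : Set ℝ) (h : ∀ R : ℝ, 0 ≤ R → R ∈ T) : sSup T = 0 := by
  refine Real.sSup_of_not_bddAbove ?_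
  rintro ⟨B, hB⟩
  have := hB (h (max 0 B + 1) (by positivity))
  linarith [le_max_right 0 B]

lemma sSup_zero_of_sub (T : Set ℝ) (h : ∀ x ∈ T, x = 0) : sSup T = 0 := by
  rcases T.eq_empty_or_nonempty with h0 | ⟨x, hx⟩
  · rw [h0, Real.sSup_empty]
  · have : T = {0} := by
      ext y
      refine ⟨fun hy => h y hy, fun hy => ?_⟩
      rw [Set.mem_singleton_iff.1 hy, ← h x hx]; exact hx
    rw [this, csSup_singleton]

lemma deg_case (M : FSMAC S Sa Sb Xa Xb Y) (hE : IsEmpty Xa ∨ IsEmpty Xb) :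
    sSup {x : ℝ | ∃ R ∈ capRegion M, x = R.1 + R.2} = 0 := by
  by_cases hA : ∃ R : ℝ × ℝ, Achievable M R.1 R.2
  · obtain ⟨R0, hR0⟩ := hA
    have hY : IsEmpty Y := by
      rcases hE with h | h
      · exact (ach_empty_a M hR0).2
      · exact (ach_empty_b M hR0).2
    rcases isEmpty_or_nonempty Xa with ea | na
    · rcases isEmpty_or_nonempty Xb with eb | nb
      · refine sSup_zero_of_sub _ ?_
        rintro x ⟨R, hR, rfl⟩
        have : capRegion M ⊆ {(0, 0)} := by
          refine closure_minimal ?_ isClosed_singleton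
          intro R hR
          exact Prod.ext (ach_empty_a M hR).1 (ach_empty_b M hR).1
        rw [Set.mem_singleton_iff.1 (this hR)]; simp
      · exact sSup_zero_of_all _ fun R hR =>
          ⟨(0, R), subset_closure (ach_deg_a M R hR), by simp⟩
    · rcases hE with h | h
      · exact (IsEmpty.false (Classical.arbitrary Xa)).elim
      · exact sSup_zero_of_all _ fun R hR =>
          ⟨(R, 0), subset_closure (ach_deg_b M R hR), by simp⟩
  · have : capRegion M = ∅ := by
      have : {R : ℝ × ℝ | Achievable M R.1 R.2} = ∅ := by
        ext R; simp only [Set.mem_ofPred_eq, Set.mem_empty_iff_false, iff_false]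
        exact fun h => hA ⟨R, h⟩
      rw [capRegion, this, closure_empty]
    simp [this]

/-- **Corollary 1 (Sum-rate capacity).** For the memoryless FS-MAC with i.i.d. state,
causal asymmetric noisy CSIT and complete CSIR, the sum-rate capacity
`C^FS_Σ = max_{(Ra,Rb) ∈ C_FS} (Ra + Rb)` equals
`sup_{π_{T^a} ⊗ π_{T^b}} I(T^a,T^b;Y|S)`. -/
theorem sum_rate_capacity {S Sa Sb Xa Xb Y : Type} [Fintype S] [Fintype Sa] [Fintype Sb]
    [Fintype Xa] [Fintype Xb] [Fintype Y] [DecidableEq Sa] [DecidableEq Sb]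
    (M : FSMAC S Sa Sb Xa Xb Y) :
    sSup {x : ℝ | ∃ R ∈ capRegion M, x = R.1 + R.2} = sumRateSup M := by
  classical
  rcases isEmpty_or_nonempty Xa with ea | na
  · rw [deg_case M (Or.inl ea)]
    have := obsA_nonempty M
    symm
    refine sSup_zero_of_sub _ ?_
    rintro x ⟨πa, πb, h, -, -⟩
    exact (no_pmf πa h).elim
  rcases isEmpty_or_nonempty Xb with eb | nb
  · rw [deg_case M (Or.inr eb)]
    have := obsB_nonempty M
    symm
    refine sSup_zero_of_sub _ ?_
    rintro x ⟨πa, πb, -, h, -⟩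
    exact (no_pmf πb h).elim
  have hle : ∀ πa πb, isPMF πa → isPMF πb → Isum M πa πb ≤ sumRateSup M :=
    fun πa πb h1 h2 => le_csSup (Isum_bdd M) ⟨πa, πb, h1, h2, rfl⟩
  have hcap : capRegion M ⊆ {R : ℝ × ℝ | R.1 + R.2 ≤ sumRateSup M} := by
    refine closure_minimal (fun R hR => converse M _ hle R.1 R.2 hR) ?_
    exact isClosed_le (by fun_prop) continuous_const
  have hbdd : BddAbove {x : ℝ | ∃ R ∈ capRegion M, x = R.1 + R.2} := by
    refine ⟨sumRateSup M, ?_⟩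
    rintro x ⟨R, hR, rfl⟩
    exact hcap hR
  obtain ⟨πa0, ha0⟩ := exists_pmf (Sa → Xa)
  obtain ⟨πb0, hb0⟩ := exists_pmf (Sb → Xb)
  refine le_antisymm (csSup_le ?_ ?_) (csSup_le ⟨_, πa0, πb0, ha0, hb0, rfl⟩ ?_)
  · obtain ⟨Ra, Rb, h, -⟩ := achiev M ha0 hb0 1 one_pos
    exact ⟨_, (Ra, Rb), subset_closure h, rfl⟩
  · rintro x ⟨R, hR, rfl⟩
    exact hcap hR
  · rintro x ⟨πa, πb, h1, h2, rfl⟩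
    refine le_of_forall_pos_le_add fun η hη => ?_
    obtain ⟨Ra, Rb, h, hle'⟩ := achiev M h1 h2 η hη
    have := le_csSup hbdd ⟨(Ra, Rb), subset_closure h, rfl⟩
    linarith
end
end

section
/- For any code on the memoryless FS-MAC with noisy CSIT and any time t, the channel output Y_t is conditionally independent of the messages, the past complete states and the past outputs given the current state S_t and the current Shannon strategies: P(Y_t=y | W=w, S_t=s, S_{[t-1]}=σ, Y_{[t-1]}=y_{[t-1]}, T_t^a=t^a, T_t^b=t^b) = Σ_{s^a∈𝒮^a, s^b∈𝒮^b} P_{Y|X^a,X^b,S}(y | t^a(s^a), t^b(s^b), s)·P_{S^a|S}(s^a|s)·P_{S^b|S}(s^b|s) = P_{Y|S,T^a,T^b}(y|s,t^a,t^b), whenever the conditioning event has positive probability. -/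
open scoped BigOperators
open Finset

noncomputable section

variable {S Sa Sb Xa Xb Y : Type} [Fintype S] [Fintype Sa] [Fintype Sb]
  [Fintype Xa] [Fintype Xb] [Fintype Y] [DecidableEq Sa] [DecidableEq Sb]

/-- The strict prefix `x_{[t-1]}` of a length-`n` sequence (entries before time `t`). -/
def prefixOf {α : Type} {n : ℕ} (x : Fin n → α) (t : Fin n) : Fin t.1 → α :=
  fun i => x (Fin.castLE t.isLt.le i)

/-- The Shannon strategy `T_t^a = φ_t^a(W_a, S^a_{[t-1]})` induced by encoder `a`
at time `t`: the map `s^a ↦ φ_t^a((S^a_{[t-1]}, s^a), W_a)`. -/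
def stratA {S Sa Sb Xa Xb Y : Type} [Fintype S] [Fintype Sa] [Fintype Sb]
    [Fintype Xa] [Fintype Xb] [Fintype Y] {M : FSMAC S Sa Sb Xa Xb Y} {n : ℕ}
    {Wa Wb : Type} (C : Code M n Wa Wb) (t : Fin n) (wa : Wa) (sa : Fin n → Sa) :
    Sa → Xa :=
  fun x => C.encA t (Fin.snoc (prefixOf sa t) x) wa

/-- The Shannon strategy `T_t^b = φ_t^b(W_b, S^b_{[t-1]})` induced by encoder `b`. -/
def stratB {S Sa Sb Xa Xb Y : Type} [Fintype S] [Fintype Sa] [Fintype Sb]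
    [Fintype Xa] [Fintype Xb] [Fintype Y] {M : FSMAC S Sa Sb Xa Xb Y} {n : ℕ}
    {Wa Wb : Type} (C : Code M n Wa Wb) (t : Fin n) (wb : Wb) (sb : Fin n → Sb) :
    Sb → Xb :=
  fun x => C.encB t (Fin.snoc (prefixOf sb t) x) wb

variable {S Sa Sb Xa Xb Y : Type} [Fintype S] [Fintype Sa] [Fintype Sb]
  [Fintype Xa] [Fintype Xb] [Fintype Y] [DecidableEq Sa] [DecidableEq Sb]

/-- Conditional joint law of `(T_t^a, T_t^b, Y_t, S_t)` given `S_{[t-1]} = σ`,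
under the code-induced law. -/
def condLaw (M : FSMAC S Sa Sb Xa Xb Y) {n : ℕ} {Wa Wb : Type}
    [Fintype Wa] [Fintype Wb] (C : Code M n Wa Wb) (t : Fin n) (σ : Fin t.1 → S) :
    ((Sa → Xa) × (Sb → Xb)) × Y × S → ℝ :=
  fun x =>
    codePr M C (fun wa wb s sa sb y =>
        prefixOf s t = σ ∧ stratA C t wa sa = x.1.1 ∧ stratB C t wb sb = x.1.2 ∧
          y t = x.2.1 ∧ s t = x.2.2) /
      codePr M C (fun _ _ s _ _ _ => prefixOf s t = σ)

/-- The strategy `φ_t^a(w_a, σ_a) ∈ 𝒯^a` obtained from encoder `a` by fixing the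
observation prefix to `σ_a` and the message to `w_a`. -/
def encStratA {M : FSMAC S Sa Sb Xa Xb Y} {n : ℕ} {Wa Wb : Type}
    (C : Code M n Wa Wb) (t : Fin n) (σa : Fin t.1 → Sa) (wa : Wa) : Sa → Xa :=
  fun x => C.encA t (Fin.snoc σa x) wa

/-- The strategy `φ_t^b(w_b, σ_b) ∈ 𝒯^b`. -/
def encStratB {M : FSMAC S Sa Sb Xa Xb Y} {n : ℕ} {Wa Wb : Type}
    (C : Code M n Wa Wb) (t : Fin n) (σb : Fin t.1 → Sb) (wb : Wb) : Sb → Xb :=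
  fun x => C.encB t (Fin.snoc σb x) wb

open Classical in
/-- `π^σ_{T^a}(t^a) = Σ_{σ_a} P(S^a_{[t-1]} = σ_a | S_{[t-1]} = σ) ·
|{w_a : φ_t^a(w_a,σ_a) = t^a}| / |𝒲_a|`. -/
def piA (M : FSMAC S Sa Sb Xa Xb Y) {n : ℕ} {Wa Wb : Type}
    [Fintype Wa] [Fintype Wb] (C : Code M n Wa Wb) (t : Fin n) (σ : Fin t.1 → S)
    (ta : Sa → Xa) : ℝ :=
  ∑ σa : Fin t.1 → Sa,
    (codePr M C (fun _ _ s sa _ _ => prefixOf s t = σ ∧ prefixOf sa t = σa) /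
        codePr M C (fun _ _ s _ _ _ => prefixOf s t = σ)) *
      ((Finset.univ.filter fun wa : Wa => encStratA C t σa wa = ta).card /
        (Fintype.card Wa : ℝ))

open Classical in
/-- `π^σ_{T^b}(t^b)`, defined analogously. -/
def piB (M : FSMAC S Sa Sb Xa Xb Y) {n : ℕ} {Wa Wb : Type}
    [Fintype Wa] [Fintype Wb] (C : Code M n Wa Wb) (t : Fin n) (σ : Fin t.1 → S)
    (tb : Sb → Xb) : ℝ :=
  ∑ σb : Fin t.1 → Sb,
    (codePr M C (fun _ _ s _ sb _ => prefixOf s t = σ ∧ prefixOf sb t = σb) /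
        codePr M C (fun _ _ s _ _ _ => prefixOf s t = σ)) *
      ((Finset.univ.filter fun wb : Wb => encStratB C t σb wb = tb).card /
        (Fintype.card Wb : ℝ))

/-- `η(ε) = (ε/(1-ε))·log₂|𝒴| + H_b(ε)/(1-ε)`. -/
def eta (Ycard : ℕ) (ε : ℝ) : ℝ :=
  ε / (1 - ε) * Real.logb 2 Ycard + binEnt ε / (1 - ε)

theorem oci_sum_update {Z : Type} [Fintype Z] {n : ℕ} (h : (Fin n → Z) → ℝ) (i : Fin n) :
    ∑ z, ∑ v, h (Function.update z i v) = (Fintype.card Z : ℝ) * ∑ z, h z := by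
  have e : ∑ p : (Fin n → Z) × Z, h (Function.update p.1 i p.2)
      = ∑ p : (Fin n → Z) × Z, h p.1 := by
    refine Finset.sum_bij' (fun p _ => (Function.update p.1 i p.2, p.1 i))
      (fun p _ => (Function.update p.1 i p.2, p.1 i)) ?_ ?_ ?_ ?_ ?_ <;> simp
  rw [Fintype.sum_prod_type, Fintype.sum_prod_type] at e
  rw [e]
  simp [Finset.mul_sum]

theorem oci_sum_zero {Z : Type} [Fintype Z] {n : ℕ} (h : (Fin n → Z) → ℝ) (i : Fin n)
    (h0 : ∀ z, ∑ v, h (Function.update z i v) = 0) : ∑ z, h z = 0 := by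
  have e := oci_sum_update h i
  simp only [h0, Finset.sum_const_zero] at e
  rcases mul_eq_zero.1 e.symm with hc | hc
  · have : IsEmpty Z := Fintype.card_eq_zero_iff.1 (by exact_mod_cast hc)
    exact Finset.sum_eq_zero fun z _ => this.elim (z i)
  · exact hc

theorem oci_sum_step {Z : Type} [Fintype Z] {n : ℕ} (F g : (Fin n → Z) → ℝ) (i : Fin n)
    (hF : ∀ z v, F (Function.update z i v) = F z)
    (hg : ∀ z, ∑ v, g (Function.update z i v) = 1)
    (h0 : ∑ z, F z = 0) : ∑ z, F z * g z = 0 := by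
  have e := oci_sum_update (fun z => F z * g z) i
  simp only [hF, ← Finset.mul_sum, hg, mul_one, h0] at e
  rcases mul_eq_zero.1 e.symm with hc | hc
  · have : IsEmpty Z := Fintype.card_eq_zero_iff.1 (by exact_mod_cast hc)
    exact Finset.sum_eq_zero fun z _ => this.elim (z i)
  · exact hc

theorem oci_causal {Z : Type} [Fintype Z] {n : ℕ} (F : (Fin n → Z) → ℝ)
    (g : Fin n → (Fin n → Z) → ℝ) (t : Fin n)
    (hF : ∀ j z v, t < j → F (Function.update z j v) = F z)
    (hg : ∀ i j z v, i < j → g i (Function.update z j v) = g i z)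
    (hg1 : ∀ i z, ∑ v, g i (Function.update z i v) = 1)
    (h0 : ∀ z, ∑ v, F (Function.update z t v) * g t (Function.update z t v) = 0) :
    ∑ z, F z * ∏ i, g i z = 0 := by
  have key : ∀ m : ℕ, t.1 ≤ m →
      ∑ z, F z * ∏ i ∈ Finset.univ.filter (fun i : Fin n => i.1 ≤ m), g i z = 0 := by
    intro m hm
    induction m, hm using Nat.le_induction with
    | base =>
      have hs : (Finset.univ.filter fun i : Fin n => i.1 ≤ t.1)
          = insert t (Finset.univ.filter fun i : Fin n => i < t) := by
        ext i
        simp only [Finset.mem_filter, Finset.mem_univ, true_and, Finset.mem_insert]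
        rw [← le_iff_eq_or_lt]; rfl
      apply oci_sum_zero _ t
      intro z
      rw [hs]
      have hp : ∀ v, ∏ i ∈ Finset.univ.filter (fun i : Fin n => i < t),
          g i (Function.update z t v)
          = ∏ i ∈ Finset.univ.filter (fun i : Fin n => i < t), g i z := by
        intro v
        refine Finset.prod_congr rfl fun i hi => hg i t z v (by simpa using hi)
      simp only [Finset.prod_insert (show t ∉ Finset.univ.filter (fun i : Fin n => i < t) by simp),
        hp, ← mul_assoc, ← Finset.sum_mul, h0, zero_mul]
    | succ m hm ih =>
      by_cases hn : m + 1 < n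
      · have hs : (Finset.univ.filter fun i : Fin n => i.1 ≤ m + 1)
            = insert ⟨m + 1, hn⟩ (Finset.univ.filter fun i : Fin n => i.1 ≤ m) := by
          ext i
          simp only [Finset.mem_filter, Finset.mem_univ, true_and, Finset.mem_insert, Fin.ext_iff]
          omega
        have := oci_sum_step
          (fun z => F z * ∏ i ∈ Finset.univ.filter (fun i : Fin n => i.1 ≤ m), g i z)
          (g ⟨m + 1, hn⟩) ⟨m + 1, hn⟩ ?_ (hg1 _) ih
        · rw [← this]
          refine Finset.sum_congr rfl fun z _ => ?_
          rw [hs, Finset.prod_insert (by simp)]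
          ring
        · intro z v
          rw [hF _ _ _ (by rw [Fin.lt_def]; simp; omega)]
          congr 1
          refine Finset.prod_congr rfl fun i hi => hg i _ z v ?_
          rw [Fin.lt_def]
          simp at hi ⊢
          omega
      · rw [← ih]
        refine Finset.sum_congr rfl fun z _ => ?_
        congr 2
        ext i
        simp only [Finset.mem_filter, Finset.mem_univ, true_and]
        omega
  have := key n t.2.le
  rw [← this]
  refine Finset.sum_congr rfl fun z _ => ?_
  rw [Finset.filter_true_of_mem fun i _ => i.2.le]

theorem oci_prefix_snoc {α : Type} {n : ℕ} (x : Fin n → α) (t : Fin n) :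
    (fun i : Fin (t.1 + 1) => x (Fin.castLE t.isLt i))
      = (Fin.snoc (prefixOf x t) (x t) : Fin (t.1 + 1) → α) := by
  funext i
  refine Fin.lastCases ?_ (fun j => ?_) i
  · rw [Fin.snoc_last]; rfl
  · rw [Fin.snoc_castSucc]; rfl

theorem oci_prefix_congr {α : Type} {n : ℕ} (x x' : Fin n → α) (t : Fin n)
    (h : ∀ i, i < t → x i = x' i) : prefixOf x t = prefixOf x' t := by
  funext i
  exact h _ (by rw [Fin.lt_def]; exact i.2)

theorem oci_sum_four {A B D E : Type} [Fintype A] [Fintype B] [Fintype D] [Fintype E] {n : ℕ}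
    (f : (Fin n → A) → (Fin n → B) → (Fin n → D) → (Fin n → E) → ℝ) :
    ∑ a, ∑ b, ∑ d, ∑ e, f a b d e = ∑ z : Fin n → A × B × D × E,
      f (fun i => (z i).1) (fun i => (z i).2.1) (fun i => (z i).2.2.1)
        (fun i => (z i).2.2.2) := by
  simp only [← Fintype.sum_prod_type']
  refine Finset.sum_bij' (fun p _ i => (p.1 i, p.2.1 i, p.2.2.1 i, p.2.2.2 i))
    (fun z _ => (fun i => (z i).1, fun i => (z i).2.1, fun i => (z i).2.2.1,
      fun i => (z i).2.2.2)) ?_ ?_ ?_ ?_ ?_ <;> simp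

/-- The output `Y_t` is conditionally independent of the messages, the past complete
states and the past outputs given the current state `S_t` and the current Shannon
strategies `(T_t^a, T_t^b)`:
`P(Y_t = y | W = w, S_t = s, S_{[t-1]} = σ, Y_{[t-1]} = y_{[t-1]}, T_t^a = t^a, T_t^b = t^b)
  = Σ_{s^a,s^b} P_{S^a|S}(s^a|s) P_{S^b|S}(s^b|s) P_{Y|X^a,X^b,S}(y|t^a(s^a),t^b(s^b),s)
  = P_{Y|S,T^a,T^b}(y|s,t^a,t^b)`,
whenever the conditioning event has positive probability. -/
theorem output_cond_indep {S Sa Sb Xa Xb Y : Type} [Fintype S] [Fintype Sa] [Fintype Sb]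
    [Fintype Xa] [Fintype Xb] [Fintype Y] [DecidableEq Sa] [DecidableEq Sb]
    (M : FSMAC S Sa Sb Xa Xb Y) {n : ℕ} {Wa Wb : Type} [Fintype Wa] [Fintype Wb]
    (C : Code M n Wa Wb) (t : Fin n) (wa : Wa) (wb : Wb) (s : S)
    (σ : Fin t.1 → S) (ypast : Fin t.1 → Y) (ta : Sa → Xa) (tb : Sb → Xb) (y : Y)
    (hpos : 0 < codePr M C (fun wa' wb' s' sa' sb' y' =>
        wa' = wa ∧ wb' = wb ∧ s' t = s ∧ prefixOf s' t = σ ∧ prefixOf y' t = ypast ∧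
          stratA C t wa' sa' = ta ∧ stratB C t wb' sb' = tb)) :
    codePr M C (fun wa' wb' s' sa' sb' y' =>
        (wa' = wa ∧ wb' = wb ∧ s' t = s ∧ prefixOf s' t = σ ∧ prefixOf y' t = ypast ∧
          stratA C t wa' sa' = ta ∧ stratB C t wb' sb' = tb) ∧ y' t = y) /
      codePr M C (fun wa' wb' s' sa' sb' y' =>
        wa' = wa ∧ wb' = wb ∧ s' t = s ∧ prefixOf s' t = σ ∧ prefixOf y' t = ypast ∧
          stratA C t wa' sa' = ta ∧ stratB C t wb' sb' = tb) =
      stratKernel M ta tb s y := by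
  classical
  rw [div_eq_iff hpos.ne', ← sub_eq_zero]
  clear hpos
  unfold codePr
  rw [Finset.mul_sum, ← Finset.sum_sub_distrib]
  refine Finset.sum_eq_zero fun wa' _ => ?_
  rw [Finset.mul_sum, ← Finset.sum_sub_distrib]
  refine Finset.sum_eq_zero fun wb' _ => ?_
  rw [oci_sum_four, oci_sum_four, Finset.mul_sum, ← Finset.sum_sub_distrib]
  -- one-step kernels
  let g : Fin n → (Fin n → S × Sa × Sb × Y) → ℝ := fun i z =>
    M.PS (z i).1 * M.Qa (z i).1 (z i).2.1 * M.Qb (z i).1 (z i).2.2.1 *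
      M.chan (stratA C i wa' (fun j => (z j).2.1) (z i).2.1)
        (stratB C i wb' (fun j => (z j).2.2.1) (z i).2.2.1) (z i).1 (z i).2.2.2
  -- past event
  let Pst : (Fin n → S × Sa × Sb × Y) → Prop := fun z =>
    wa' = wa ∧ wb' = wb ∧ prefixOf (fun j => (z j).1) t = σ ∧
      prefixOf (fun j => (z j).2.2.2) t = ypast ∧
      stratA C t wa' (fun j => (z j).2.1) = ta ∧ stratB C t wb' (fun j => (z j).2.2.1) = tb
  let F : (Fin n → S × Sa × Sb × Y) → ℝ := fun z =>
    if Pst z then (if (z t).1 = s then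
      (if (z t).2.2.2 = y then 1 else 0) - stratKernel M ta tb s y else 0) else 0
  have hlt : ∀ {β : Type} (f : S × Sa × Sb × Y → β) (i j : Fin n)
      (z : Fin n → S × Sa × Sb × Y) (v), i ≤ j →
      prefixOf (fun k => f (Function.update z j v k)) i = prefixOf (fun k => f (z k)) i := by
    intro β f i j z v hij
    apply oci_prefix_congr
    intro k hk
    rw [Function.update_of_ne (hk.trans_le hij).ne]
  have hsA : ∀ (i j : Fin n) (z : Fin n → S × Sa × Sb × Y) (v), i ≤ j →
      stratA C i wa' (fun k => (Function.update z j v k).2.1)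
        = stratA C i wa' (fun k => (z k).2.1) := by
    intro i j z v hij
    unfold stratA
    rw [hlt (fun q => q.2.1) i j z v hij]
  have hsB : ∀ (i j : Fin n) (z : Fin n → S × Sa × Sb × Y) (v), i ≤ j →
      stratB C i wb' (fun k => (Function.update z j v k).2.2.1)
        = stratB C i wb' (fun k => (z k).2.2.1) := by
    intro i j z v hij
    unfold stratB
    rw [hlt (fun q => q.2.2.1) i j z v hij]
  have hP : ∀ (j : Fin n) (z : Fin n → S × Sa × Sb × Y) (v), t ≤ j →
      Pst (Function.update z j v) = Pst z := by
    intro j z v hj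
    simp only [Pst]
    rw [hsA t j z v hj, hsB t j z v hj, hlt (fun q => q.1) t j z v hj,
      hlt (fun q => q.2.2.2) t j z v hj]
  have hgu : ∀ (i : Fin n) (z : Fin n → S × Sa × Sb × Y) (v),
      g i (Function.update z i v) = M.PS v.1 * M.Qa v.1 v.2.1 * M.Qb v.1 v.2.2.1 *
        M.chan (stratA C i wa' (fun j => (z j).2.1) v.2.1)
          (stratB C i wb' (fun j => (z j).2.2.1) v.2.2.1) v.1 v.2.2.2 := by
    intro i z v
    simp only [g]
    rw [hsA i i z v le_rfl, hsB i i z v le_rfl]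
    simp only [Function.update_self]
  have main := oci_causal F g t ?_ ?_ ?_ ?_
  · have h2 := congrArg
      (fun x => (Fintype.card Wa : ℝ)⁻¹ * (Fintype.card Wb : ℝ)⁻¹ * x) main
    simp only [mul_zero, Finset.mul_sum] at h2
    refine Eq.trans ?_ h2
    refine Finset.sum_congr rfl fun z _ => ?_
    have hc : codeProb M C wa' wb' (fun i => (z i).1) (fun i => (z i).2.1)
        (fun i => (z i).2.2.1) (fun i => (z i).2.2.2)
        = (Fintype.card Wa : ℝ)⁻¹ * (Fintype.card Wb : ℝ)⁻¹ * ∏ i, g i z := by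
      unfold codeProb
      congr 1
      refine Finset.prod_congr rfl fun i _ => ?_
      rw [oci_prefix_snoc (fun i => (z i).2.1) i, oci_prefix_snoc (fun i => (z i).2.2.1) i]
      rfl
    rw [hc]
    have hE : (wa' = wa ∧ wb' = wb ∧ (z t).1 = s ∧ prefixOf (fun i => (z i).1) t = σ ∧
        prefixOf (fun i => (z i).2.2.2) t = ypast ∧
        stratA C t wa' (fun i => (z i).2.1) = ta ∧
        stratB C t wb' (fun i => (z i).2.2.1) = tb) ↔ (Pst z ∧ (z t).1 = s) := by
      simp only [Pst]; tauto
    simp only [hE, F]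
    by_cases h1 : Pst z <;> by_cases h3 : (z t).1 = s <;> by_cases h4 : (z t).2.2.2 = y <;>
      simp [h1, h3, h4] <;> ring
  · intro j z v hj
    simp only [F, hP j z v hj.le, Function.update_of_ne hj.ne]
  · intro i j z v hij
    simp only [g]
    rw [hsA i j z v hij.le, hsB i j z v hij.le]
    simp only [Function.update_of_ne hij.ne]
  · intro i z
    simp only [hgu, Fintype.sum_prod_type, ← Finset.mul_sum, (M.chan_pmf _ _ _).2,
      (M.Qa_pmf _).2, (M.Qb_pmf _).2, M.PS_pmf.2, mul_one]
  · intro z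
    simp only [hgu]
    simp only [F, hP t z _ le_rfl, Function.update_self]
    by_cases h : Pst z
    · obtain ⟨-, -, -, -, hA, hB⟩ := id h
      simp only [h, if_true, hA, hB, Fintype.sum_prod_type]
      refine Finset.sum_eq_zero fun s' _ => ?_
      by_cases hs : s' = s
      · subst hs
        simp only [if_true]
        have e1 : ∀ sa sb, ∑ y', ((if y' = y then (1 : ℝ) else 0) - stratKernel M ta tb s' y) *
            (M.PS s' * M.Qa s' sa * M.Qb s' sb * M.chan (ta sa) (tb sb) s' y')
            = M.PS s' * (M.Qa s' sa * M.Qb s' sb * M.chan (ta sa) (tb sb) s' y)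
              - M.PS s' * stratKernel M ta tb s' y * (M.Qa s' sa * M.Qb s' sb) := by
          intro sa sb
          simp only [sub_mul, Finset.sum_sub_distrib, ite_mul, one_mul, zero_mul,
            Finset.sum_ite_eq', Finset.mem_univ, if_true, ← Finset.mul_sum,
            (M.chan_pmf _ _ _).2]
          ring
        simp only [e1, Finset.sum_sub_distrib, ← Finset.mul_sum, (M.Qa_pmf _).2,
          (M.Qb_pmf _).2, mul_one]
        simp only [stratKernel, sub_self]
      · simp [hs]
    · simp [h]
end
end
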